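/- (Semi-wave.) Assume (A1)–(A3) hold and bc − ad > 0. Then there exists a constant s* > 0 such that for every s ∈ [0, s*), the semi-wave system (1.5) has a unique strictly increasing solution (φ_s, ψ_s) ∈ C²([0,+∞)) × C²([0,+∞)), and system (1.5) has no strictly increasing solution when s ≥ s*. Moreover, for any μ > 0 and ρ > 0, there exists a unique s_{μ,ρ} ∈ (0, s*) such that μ[ψ'_{s_{μ,ρ}}(0) + ρ·φ'_{s_{μ,ρ}}(0)] = s_{μ,ρ}. -/

import Mathlib

open Set Filter Topology

noncomputable section

/-- First spatial derivative. -/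
def pdx (w : ℝ → ℝ → ℝ) (x t : ℝ) : ℝ := deriv (fun y => w y t) x

/-- Second spatial derivative. -/
def pdxx (w : ℝ → ℝ → ℝ) (x t : ℝ) : ℝ := deriv (fun y => pdx w y t) x

/-- Time derivative. -/
def pdt (w : ℝ → ℝ → ℝ) (x t : ℝ) : ℝ := deriv (fun s => w x s) t

/-- Left-sided spatial derivative (used at the right free boundary). -/
def pdxL (w : ℝ → ℝ → ℝ) (x t : ℝ) : ℝ := derivWithin (fun y => w y t) (Iic x) x

/-- Right-sided spatial derivative (used at the left free boundary). -/
def pdxR (w : ℝ → ℝ → ℝ) (x t : ℝ) : ℝ := derivWithin (fun y => w y t) (Ici x) x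

/-- Conditions (A1)-(A3) on the loss functions F and G. -/
structure CondA (F G : ℝ → ℝ) : Prop where
  regF : ContDiffOn ℝ 2 F (Ici 0)
  regG : ContDiffOn ℝ 2 G (Ici 0)
  monoF : MonotoneOn F (Ici 0)
  monoG : MonotoneOn G (Ici 0)
  zeroF : F 0 = 0
  zeroG : G 0 = 0
  dzeroF : derivWithin F (Ici 0) 0 = 0
  dzeroG : derivWithin G (Ici 0) 0 = 0
  ratioF : StrictMonoOn (fun z => F z / z) (Ioi 0)
  ratioG : StrictMonoOn (fun z => G z / z) (Ioi 0)
  infF : Tendsto (fun z => F z / z) atTop atTop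
  infG : Tendsto (fun z => G z / z) atTop atTop

/-- Condition (1.3) on the initial data. -/
structure InitData (h0 : ℝ) (u0 v0 : ℝ → ℝ) : Prop where
  regU : ContDiffOn ℝ 2 u0 (Icc (-h0) h0)
  regV : ContDiffOn ℝ 2 v0 (Icc (-h0) h0)
  uL : u0 (-h0) = 0
  uR : u0 h0 = 0
  vL : v0 (-h0) = 0
  vR : v0 h0 = 0
  uPos : ∀ x ∈ Ioo (-h0) h0, 0 < u0 x
  vPos : ∀ x ∈ Ioo (-h0) h0, 0 < v0 x

/-- (u,v,g,h) is a classical solution of the free boundary problem (1.2). -/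
structure IsSol (d1 d2 a b c d μ ρ h0 : ℝ) (F G u0 v0 : ℝ → ℝ)
    (u v : ℝ → ℝ → ℝ) (g h : ℝ → ℝ) : Prop where
  gltH : ∀ t ≥ (0:ℝ), g t < h t
  contU : ContinuousOn (fun p : ℝ × ℝ => u p.1 p.2)
    {p : ℝ × ℝ | 0 ≤ p.2 ∧ p.1 ∈ Icc (g p.2) (h p.2)}
  contV : ContinuousOn (fun p : ℝ × ℝ => v p.1 p.2)
    {p : ℝ × ℝ | 0 ≤ p.2 ∧ p.1 ∈ Icc (g p.2) (h p.2)}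
  diffG : ∀ t > (0:ℝ), DifferentiableAt ℝ g t
  diffH : ∀ t > (0:ℝ), DifferentiableAt ℝ h t
  regU : ∀ t > (0:ℝ), ∀ x ∈ Ioo (g t) (h t),
    DifferentiableAt ℝ (fun y => u y t) x ∧ DifferentiableAt ℝ (fun y => pdx u y t) x ∧
      DifferentiableAt ℝ (fun s => u x s) t
  regV : ∀ t > (0:ℝ), ∀ x ∈ Ioo (g t) (h t),
    DifferentiableAt ℝ (fun y => v y t) x ∧ DifferentiableAt ℝ (fun y => pdx v y t) x ∧
      DifferentiableAt ℝ (fun s => v x s) t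
  pdeU : ∀ t > (0:ℝ), ∀ x ∈ Ioo (g t) (h t),
    pdt u x t - d1 * pdxx u x t = -a * u x t + b * v x t - F (u x t)
  pdeV : ∀ t > (0:ℝ), ∀ x ∈ Ioo (g t) (h t),
    pdt v x t - d2 * pdxx v x t = c * u x t - d * v x t - G (v x t)
  bcUL : ∀ t > (0:ℝ), u (g t) t = 0
  bcUR : ∀ t > (0:ℝ), u (h t) t = 0
  bcVL : ∀ t > (0:ℝ), v (g t) t = 0
  bcVR : ∀ t > (0:ℝ), v (h t) t = 0
  stefanH : ∀ t > (0:ℝ), deriv h t = -μ * (pdxL v (h t) t + ρ * pdxL u (h t) t)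
  stefanG : ∀ t > (0:ℝ), deriv g t = -μ * (pdxR v (g t) t + ρ * pdxR u (g t) t)
  initG : g 0 = -h0
  initH : h 0 = h0
  initU : ∀ x ∈ Icc (-h0) h0, u x 0 = u0 x
  initV : ∀ x ∈ Icc (-h0) h0, v x 0 = v0 x

/-- Membership of a function of (x,t), on the moving domain determined by g and h,
in the parabolic Hölder space `C^{2+α,1+α/2}`. -/
def ParabolicHolder (α : ℝ) (w : ℝ → ℝ → ℝ) (g h : ℝ → ℝ) : Prop :=
  (∀ t > (0:ℝ), ∀ x ∈ Ioo (g t) (h t),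
    DifferentiableAt ℝ (fun y => w y t) x ∧ DifferentiableAt ℝ (fun y => pdx w y t) x ∧
      DifferentiableAt ℝ (fun s => w x s) t) ∧
  ∃ M > (0:ℝ), ∀ t > (0:ℝ), ∀ s > (0:ℝ), ∀ x ∈ Ioo (g t) (h t), ∀ y ∈ Ioo (g s) (h s),
    |w x t - w y s| ≤ M * (|x - y| + |t - s| ^ ((1:ℝ)/2)) ∧
    |pdx w x t - pdx w y s| ≤ M * (|x - y| ^ α + |t - s| ^ ((1+α)/2)) ∧
    |pdxx w x t - pdxx w y s| ≤ M * (|x - y| ^ α + |t - s| ^ (α/2)) ∧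
    |pdt w x t - pdt w y s| ≤ M * (|x - y| ^ α + |t - s| ^ (α/2))

/-- Membership of a one-variable function in `C^{1+β}((0,∞))`. -/
def COneHolder (β : ℝ) (g : ℝ → ℝ) : Prop :=
  (∀ t > (0:ℝ), DifferentiableAt ℝ g t) ∧
  ∃ M > (0:ℝ), ∀ t > (0:ℝ), ∀ s > (0:ℝ), |deriv g t - deriv g s| ≤ M * |t - s| ^ β

/-- (ustar, vstar) is a positive equilibrium of the kinetic system. -/
def IsEquilibrium (a b c d : ℝ) (F G : ℝ → ℝ) (ustar vstar : ℝ) : Prop :=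
  0 < ustar ∧ 0 < vstar ∧
    -a * ustar + b * vstar - F ustar = 0 ∧ c * ustar - d * vstar - G vstar = 0

/-- (φ,ψ) is a solution of the semi-wave system (1.5) with speed s. -/
structure SemiWave (d1 d2 a b c d : ℝ) (F G : ℝ → ℝ) (ustar vstar s : ℝ)
    (φ ψ : ℝ → ℝ) : Prop where
  regφ : ContDiffOn ℝ 2 φ (Ici 0)
  regψ : ContDiffOn ℝ 2 ψ (Ici 0)
  odeφ : ∀ ξ > (0:ℝ),
    d1 * deriv (deriv φ) ξ - s * deriv φ ξ - a * φ ξ + b * ψ ξ - F (φ ξ) = 0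
  odeψ : ∀ ξ > (0:ℝ),
    d2 * deriv (deriv ψ) ξ - s * deriv ψ ξ + c * φ ξ - d * ψ ξ - G (ψ ξ) = 0
  zeroφ : φ 0 = 0
  zeroψ : ψ 0 = 0
  limφ : Tendsto φ atTop (𝓝 ustar)
  limψ : Tendsto ψ atTop (𝓝 vstar)

/-- (φ,ψ) is a strictly increasing solution of the semi-wave system (1.5) with speed s. -/
def IncSemiWave (d1 d2 a b c d : ℝ) (F G : ℝ → ℝ) (ustar vstar s : ℝ)
    (φ ψ : ℝ → ℝ) : Prop :=
  SemiWave d1 d2 a b c d F G ustar vstar s φ ψ ∧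
    StrictMonoOn φ (Ici 0) ∧ StrictMonoOn ψ (Ici 0)

/-- sstar is the critical speed s* of Proposition 1.2: for 0 ≤ s < s* the semi-wave
system has a unique strictly increasing solution, and none for s ≥ s*. -/
def IsCriticalSpeed (d1 d2 a b c d : ℝ) (F G : ℝ → ℝ) (ustar vstar sstar : ℝ) : Prop :=
  0 < sstar ∧
  (∀ s, 0 ≤ s → s < sstar →
    ∃ φ ψ, IncSemiWave d1 d2 a b c d F G ustar vstar s φ ψ ∧
      ∀ φ' ψ', IncSemiWave d1 d2 a b c d F G ustar vstar s φ' ψ' →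
        EqOn φ φ' (Ici 0) ∧ EqOn ψ ψ' (Ici 0)) ∧
  (∀ s, sstar ≤ s → ¬ ∃ φ ψ, IncSemiWave d1 d2 a b c d F G ustar vstar s φ ψ)

/-- s is the speed s_{μ,ρ}: the unique s ∈ (0,s*) for which the semi-wave with speed s
satisfies the free boundary compatibility condition (s mu). -/
def IsSpeedMuRho (d1 d2 a b c d μ ρ : ℝ) (F G : ℝ → ℝ) (ustar vstar sstar s : ℝ) : Prop :=
  s ∈ Ioo 0 sstar ∧
  ∃ φ ψ, IncSemiWave d1 d2 a b c d F G ustar vstar s φ ψ ∧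
    μ * (derivWithin ψ (Ici 0) 0 + ρ * derivWithin φ (Ici 0) 0) = s

structure Par where
  d1 : ℝ
  d2 : ℝ
  a : ℝ
  b : ℝ
  c : ℝ
  d : ℝ
  u : ℝ
  v : ℝ
  L : ℝ
  F : ℝ → ℝ
  G : ℝ → ℝ

structure Good (P : Par) : Prop where
  d1 : 0 < P.d1
  d2 : 0 < P.d2
  a : 0 < P.a
  b : 0 < P.b
  c : 0 < P.c
  d : 0 < P.d
  u : 0 < P.u
  v : 0 < P.v
  L : 0 ≤ P.L
  bcad : 0 < P.b * P.c - P.a * P.d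
  F0 : P.F 0 = 0
  G0 : P.G 0 = 0
  mF : MonotoneOn P.F (Ici 0)
  mG : MonotoneOn P.G (Ici 0)
  rF : StrictMonoOn (fun z => P.F z / z) (Ioi 0)
  rG : StrictMonoOn (fun z => P.G z / z) (Ioi 0)
  lF : ∀ x ∈ Icc 0 P.u, ∀ y ∈ Icc 0 P.u, |P.F x - P.F y| ≤ P.L * |x - y|
  lG : ∀ x ∈ Icc 0 P.v, ∀ y ∈ Icc 0 P.v, |P.G x - P.G y| ≤ P.L * |x - y|
  sF : ∀ ε > 0, ∃ δ > 0, ∀ z, 0 ≤ z → z ≤ δ → P.F z ≤ ε * z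
  sG : ∀ ε > 0, ∃ δ > 0, ∀ z, 0 ≤ z → z ≤ δ → P.G z ≤ ε * z
  e1 : P.a * P.u + P.F P.u = P.b * P.v
  e2 : P.d * P.v + P.G P.v = P.c * P.u

def Par.swap (P : Par) : Par :=
  ⟨P.d2, P.d1, P.d, P.c, P.b, P.a, P.v, P.u, P.L, P.G, P.F⟩

lemma Good.swap {P : Par} (h : Good P) : Good P.swap where
  d1 := h.d2
  d2 := h.d1
  a := h.d
  b := h.c
  c := h.b
  d := h.a
  u := h.v
  v := h.u
  L := h.L
  bcad := by have := h.bcad; simp only [Par.swap]; linarith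
  F0 := h.G0
  G0 := h.F0
  mF := h.mG
  mG := h.mF
  rF := h.rG
  rG := h.rF
  lF := h.lG
  lG := h.lF
  sF := h.sG
  sG := h.sF
  e1 := h.e2
  e2 := h.e1

structure MS (P : Par) (s : ℝ) (D : Set ℝ) (φ ψ φ1 ψ1 : ℝ → ℝ) : Prop where
  op : IsOpen D
  up : IsUpperSet D
  hφ : ∀ x ∈ D, HasDerivAt φ (φ1 x) x
  hψ : ∀ x ∈ D, HasDerivAt ψ (ψ1 x) x
  hφ1 : ∀ x ∈ D, HasDerivAt φ1 ((s * φ1 x + P.a * φ x - P.b * ψ x + P.F (φ x)) / P.d1) x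
  hψ1 : ∀ x ∈ D, HasDerivAt ψ1 ((s * ψ1 x + P.d * ψ x - P.c * φ x + P.G (ψ x)) / P.d2) x
  mφ : MonotoneOn φ D
  mψ : MonotoneOn ψ D
  rφ : ∀ x ∈ D, φ x ∈ Icc 0 P.u
  rψ : ∀ x ∈ D, ψ x ∈ Icc 0 P.v

lemma MS.swap {P : Par} {s : ℝ} {D : Set ℝ} {φ ψ φ1 ψ1 : ℝ → ℝ} (h : MS P s D φ ψ φ1 ψ1) :
    MS P.swap s D ψ φ ψ1 φ1 :=
  ⟨h.op, h.up, h.hψ, h.hφ, h.hψ1, h.hφ1, h.mψ, h.mφ, h.rψ, h.rφ⟩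

lemma MS.restrict {P : Par} {s : ℝ} {D D' : Set ℝ} {φ ψ φ1 ψ1 : ℝ → ℝ}
    (h : MS P s D φ ψ φ1 ψ1) (o : IsOpen D') (u : IsUpperSet D') (hs : D' ⊆ D) :
    MS P s D' φ ψ φ1 ψ1 :=
  ⟨o, u, fun x hx => h.hφ x (hs hx), fun x hx => h.hψ x (hs hx), fun x hx => h.hφ1 x (hs hx),
    fun x hx => h.hψ1 x (hs hx), h.mφ.mono hs, h.mψ.mono hs, fun x hx => h.rφ x (hs hx),
    fun x hx => h.rψ x (hs hx)⟩

lemma MS.shift {P : Par} {s : ℝ} {D : Set ℝ} {φ ψ φ1 ψ1 : ℝ → ℝ}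
    (h : MS P s D φ ψ φ1 ψ1) (t : ℝ) :
    MS P s {x | x + t ∈ D} (fun x => φ (x + t)) (fun x => ψ (x + t))
      (fun x => φ1 (x + t)) (fun x => ψ1 (x + t)) := by
  refine ⟨h.op.preimage (by fun_prop), ?_, ?_, ?_, ?_, ?_, ?_, ?_, ?_, ?_⟩
  · intro x y hxy hx
    exact h.up (by linarith : x + t ≤ y + t) hx
  · intro x hx; exact (h.hφ _ hx).comp_add_const x t
  · intro x hx; exact (h.hψ _ hx).comp_add_const x t
  · intro x hx; exact (h.hφ1 _ hx).comp_add_const x t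
  · intro x hx; exact (h.hψ1 _ hx).comp_add_const x t
  · intro x hx y hy hxy; exact h.mφ hx hy (by linarith)
  · intro x hx y hy hxy; exact h.mψ hx hy (by linarith)
  · intro x hx; exact h.rφ _ hx
  · intro x hx; exact h.rψ _ hx

def Par.M (P : Par) : ℝ := P.a * P.u + P.b * P.v + P.F P.u
def Par.C1 (P : Par) : ℝ := P.u + P.M / P.d1
def Par.C2 (P : Par) (S : ℝ) : ℝ := (S * P.C1 + P.M) / P.d1

lemma Good.Fnn {P : Par} (g : Good P) {x : ℝ} (hx : 0 ≤ x) : 0 ≤ P.F x := by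
  rw [← g.F0]; exact g.mF (mem_Ici.2 le_rfl) (mem_Ici.2 hx) hx

lemma Good.M_nn {P : Par} (g : Good P) : 0 ≤ P.M := by
  have := g.Fnn g.u.le
  have := mul_pos g.a g.u
  have := mul_pos g.b g.v
  unfold Par.M; linarith

lemma Good.C1_nn {P : Par} (g : Good P) : 0 ≤ P.C1 := by
  have := div_nonneg g.M_nn g.d1.le
  have := g.u
  unfold Par.C1; linarith

lemma MS.R_abs {P : Par} (g : Good P) {s : ℝ} {D : Set ℝ} {φ ψ φ1 ψ1 : ℝ → ℝ}
    (h : MS P s D φ ψ φ1 ψ1) {x : ℝ} (hx : x ∈ D) :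
    |P.a * φ x - P.b * ψ x + P.F (φ x)| ≤ P.M := by
  obtain ⟨h1, h2⟩ := h.rφ x hx
  obtain ⟨h3, h4⟩ := h.rψ x hx
  have h5 := g.Fnn h1
  have h6 : P.F (φ x) ≤ P.F P.u := g.mF (mem_Ici.2 h1) (mem_Ici.2 g.u.le) h2
  have h7 := mul_le_mul_of_nonneg_left h2 g.a.le
  have h8 := mul_le_mul_of_nonneg_left h4 g.b.le
  have h9 := mul_nonneg g.a.le h1
  have h10 := mul_nonneg g.b.le h3
  have := mul_pos g.a g.u
  have := mul_pos g.b g.v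
  unfold Par.M
  rw [abs_le]; constructor <;> linarith

lemma MS.φ1_nn {P : Par} {s : ℝ} {D : Set ℝ} {φ ψ φ1 ψ1 : ℝ → ℝ}
    (h : MS P s D φ ψ φ1 ψ1) {x : ℝ} (hx : x ∈ D) : 0 ≤ φ1 x := by
  have h1 := h.mφ.derivWithin_nonneg (x := x)
  rwa [derivWithin_of_isOpen h.op hx, (h.hφ x hx).deriv] at h1

lemma lip_of_deriv {f f' : ℝ → ℝ} {D : Set ℝ} (hD : IsUpperSet D) {C : ℝ}
    (h : ∀ x ∈ D, HasDerivAt f (f' x) x) (hC : ∀ x ∈ D, |f' x| ≤ C) {x y : ℝ}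
    (hx : x ∈ D) (hy : y ∈ D) : |f x - f y| ≤ C * |x - y| := by
  have hc : Convex ℝ D := hD.ordConnected.convex
  have := hc.norm_image_sub_le_of_norm_hasDerivWithin_le (f := f) (f' := f') (C := C)
    (fun x hx => (h x hx).hasDerivWithinAt) (fun x hx => hC x hx) hy hx
  simpa [Real.norm_eq_abs] using this

lemma MS.φ1_le {P : Par} (g : Good P) {s : ℝ} (hs : 0 ≤ s) {D : Set ℝ} {φ ψ φ1 ψ1 : ℝ → ℝ}
    (h : MS P s D φ ψ φ1 ψ1) {x : ℝ} (hx : x ∈ D) : φ1 x ≤ P.C1 := by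
  have hsub : ∀ y, x ≤ y → y ∈ D := fun y hy => h.up hy hx
  obtain ⟨η, hη, he⟩ := exists_hasDerivAt_eq_slope φ φ1 (by linarith : x < x + 1)
    (fun y hy => (h.hφ y (hsub y hy.1)).continuousAt.continuousWithinAt)
    (fun y hy => h.hφ y (hsub y hy.1.le))
  have h1 := (h.rφ x hx).1
  have h2 := (h.rφ (x+1) (hsub _ (by linarith))).2
  have h3 : φ1 η ≤ P.u := by rw [he]; simp; linarith
  obtain ⟨ζ, hζ, hz⟩ := exists_hasDerivAt_eq_slope φ1 _ hη.1
    (fun y hy => (h.hφ1 y (hsub y hy.1)).continuousAt.continuousWithinAt)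
    (fun y hy => h.hφ1 y (hsub y hy.1.le))
  have hζD := hsub ζ hζ.1.le
  have h4 := (abs_le.1 (h.R_abs g hζD)).1
  have h5 := mul_nonneg hs (h.φ1_nn hζD)
  have h6 : -(P.M / P.d1) ≤ (s * φ1 ζ + P.a * φ ζ - P.b * ψ ζ + P.F (φ ζ)) / P.d1 := by
    rw [← neg_div]; exact div_le_div_of_nonneg_right (by linarith) g.d1.le
  rw [hz, le_div_iff₀ (by linarith [hη.1])] at h6
  have h7 := div_nonneg g.M_nn g.d1.le
  have h8 : η - x ≤ 1 := by linarith [hη.2]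
  have h9 : 0 ≤ η - x := by linarith [hη.1]
  unfold Par.C1
  nlinarith

lemma MS.φ1_abs {P : Par} (g : Good P) {s : ℝ} (hs : 0 ≤ s) {D : Set ℝ} {φ ψ φ1 ψ1 : ℝ → ℝ}
    (h : MS P s D φ ψ φ1 ψ1) {x : ℝ} (hx : x ∈ D) : |φ1 x| ≤ P.C1 := by
  rw [abs_of_nonneg (h.φ1_nn hx)]; exact h.φ1_le g hs hx

lemma MS.φ2_abs {P : Par} (g : Good P) {s S : ℝ} (hs : 0 ≤ s) (hS : s ≤ S) {D : Set ℝ}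
    {φ ψ φ1 ψ1 : ℝ → ℝ}
    (h : MS P s D φ ψ φ1 ψ1) {x : ℝ} (hx : x ∈ D) :
    |(s * φ1 x + P.a * φ x - P.b * ψ x + P.F (φ x)) / P.d1| ≤ P.C2 S := by
  unfold Par.C2
  rw [abs_div, abs_of_pos g.d1]
  refine div_le_div_of_nonneg_right ?_ g.d1.le
  have h1 := h.R_abs g hx
  have h2 := h.φ1_nn hx
  have h3 := h.φ1_le g hs hx
  have h4 : s * φ1 x ≤ S * P.C1 := mul_le_mul hS h3 h2 (hs.trans hS)
  have h5 := mul_nonneg hs h2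
  rw [abs_le] at *
  constructor <;> linarith [h1.1, h1.2]

lemma MS.φ_lip {P : Par} (g : Good P) {s : ℝ} (hs : 0 ≤ s) {D : Set ℝ} {φ ψ φ1 ψ1 : ℝ → ℝ}
    (h : MS P s D φ ψ φ1 ψ1) {x y : ℝ} (hx : x ∈ D) (hy : y ∈ D) :
    |φ x - φ y| ≤ P.C1 * |x - y| :=
  lip_of_deriv h.up h.hφ (fun _ hx => h.φ1_abs g hs hx) hx hy

lemma MS.φ1_lip {P : Par} (g : Good P) {s S : ℝ} (hs : 0 ≤ s) (hS : s ≤ S) {D : Set ℝ}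
    {φ ψ φ1 ψ1 : ℝ → ℝ}
    (h : MS P s D φ ψ φ1 ψ1) {x y : ℝ} (hx : x ∈ D) (hy : y ∈ D) :
    |φ1 x - φ1 y| ≤ P.C2 S * |x - y| :=
  lip_of_deriv h.up h.hφ1 (fun _ hx => h.φ2_abs g hs hS hx) hx hy

def Par.C3 (P : Par) (S : ℝ) : ℝ :=
  (S * P.C2 S + P.a * P.C1 + P.b * P.swap.C1 + P.L * P.C1) / P.d1

lemma MS.φ2_lip {P : Par} (g : Good P) {s S : ℝ} (hs : 0 ≤ s) (hS : s ≤ S) {D : Set ℝ}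
    {φ ψ φ1 ψ1 : ℝ → ℝ}
    (h : MS P s D φ ψ φ1 ψ1) {x y : ℝ} (hx : x ∈ D) (hy : y ∈ D) :
    |(s * φ1 x + P.a * φ x - P.b * ψ x + P.F (φ x)) / P.d1 -
      (s * φ1 y + P.a * φ y - P.b * ψ y + P.F (φ y)) / P.d1| ≤ P.C3 S * |x - y| := by
  unfold Par.C3
  rw [← sub_div, abs_div, abs_of_pos g.d1, div_mul_eq_mul_div]
  refine div_le_div_of_nonneg_right ?_ g.d1.le
  have h1 := h.φ_lip g hs hx hy
  have h2 := h.swap.φ_lip g.swap hs hx hy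
  have h3 := h.φ1_lip g hs hS hx hy
  have h4 := g.lF _ (h.rφ x hx) _ (h.rφ y hy)
  have e1 : |s * (φ1 x - φ1 y)| ≤ S * (P.C2 S * |x - y|) := by
    rw [abs_mul, abs_of_nonneg hs]
    exact mul_le_mul hS h3 (abs_nonneg _) (hs.trans hS)
  have e2 : |P.a * (φ x - φ y)| ≤ P.a * (P.C1 * |x - y|) := by
    rw [abs_mul, abs_of_pos g.a]; exact mul_le_mul_of_nonneg_left h1 g.a.le
  have e3 : |P.b * (ψ x - ψ y)| ≤ P.b * (P.swap.C1 * |x - y|) := by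
    rw [abs_mul, abs_of_pos g.b]; exact mul_le_mul_of_nonneg_left h2 g.b.le
  have e4 : |P.F (φ x) - P.F (φ y)| ≤ P.L * (P.C1 * |x - y|) :=
    h4.trans (mul_le_mul_of_nonneg_left h1 g.L)
  rw [abs_le] at *
  constructor <;> nlinarith [e1.1, e1.2, e2.1, e2.2, e3.1, e3.2, e4.1, e4.2]

lemma hasDeriv_lim {ι : Type*} {l : Filter ι} [NeBot l] {f g : ι → ℝ → ℝ} {f0 : ℝ → ℝ}
    {g0 x0 x C : ℝ} (hx : x0 < x)
    (h : ∀ᶠ i in l, ∀ y > x0, HasDerivAt (f i) (g i y) y)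
    (hL : ∀ᶠ i in l, ∀ y > x0, ∀ z > x0, |g i y - g i z| ≤ C * |y - z|)
    (tf : ∀ y > x0, Tendsto (fun i => f i y) l (𝓝 (f0 y)))
    (tg : Tendsto (fun i => g i x) l (𝓝 g0)) : HasDerivAt f0 g0 x := by
  have key : ∀ y > x0, |f0 y - f0 x - (y - x) * g0| ≤ |C| * |y - x| * |y - x| := by
    intro y hy
    have t : Tendsto (fun i => |f i y - f i x - (y - x) * g i x|) l
        (𝓝 (|f0 y - f0 x - (y - x) * g0|)) :=
      ((((tf y hy).sub (tf x hx)).sub (tg.const_mul _))).abs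
    refine le_of_tendsto t ?_
    filter_upwards [h, hL] with i hi hLi
    have hc : Convex ℝ (uIcc x y) := convex_uIcc x y
    have hsub : ∀ z ∈ uIcc x y, x0 < z := by
      intro z hz
      rcases le_total x y with hh | hh
      · rw [uIcc_of_le hh] at hz; linarith [hz.1]
      · rw [uIcc_of_ge hh] at hz; exact lt_of_lt_of_le hy hz.1
    have := hc.norm_image_sub_le_of_norm_hasDerivWithin_le (f := fun z => f i z - z * g i x)
      (f' := fun z => g i z - 1 * g i x) (C := |C| * |y - x|) (x := x) (y := y)
      (fun z hz => ((hi z (hsub z hz)).sub ((hasDerivAt_id z).mul_const _)).hasDerivWithinAt)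
      (fun z hz => by
        have h1 := hLi z (hsub z hz) x hx
        have h2 : |z - x| ≤ |y - x| := abs_sub_left_of_mem_uIcc hz
        rw [Real.norm_eq_abs, one_mul]
        refine h1.trans ?_
        exact mul_le_mul (le_abs_self C) h2 (abs_nonneg _) (abs_nonneg _))
      left_mem_uIcc right_mem_uIcc
    simp only [Real.norm_eq_abs] at this
    have e : f i y - f i x - (y - x) * g i x = f i y - y * g i x - (f i x - x * g i x) := by ring
    rw [e]; exact this
  rw [hasDerivAt_iff_isLittleO]
  rw [Asymptotics.isLittleO_iff]
  intro ε hε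
  have hn : ∀ᶠ y in 𝓝 x, |y - x| < ε / (|C| + 1) := by
    have : Tendsto (fun y => |y - x|) (𝓝 x) (𝓝 |x - x|) := by
      apply Continuous.tendsto; fun_prop
    rw [sub_self, abs_zero] at this
    exact this.eventually (gt_mem_nhds (by positivity))
  filter_upwards [hn, lt_mem_nhds hx] with y hy hy0
  have := key y hy0
  simp only [Real.norm_eq_abs, smul_eq_mul]
  refine this.trans (mul_le_mul_of_nonneg_right ?_ (abs_nonneg _))
  rw [lt_div_iff₀ (by positivity)] at hy
  nlinarith [abs_nonneg C, abs_nonneg (y - x)]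

lemma ulim {ι : Type*} (U : Ultrafilter ι) {f : ι → ℝ} {p q : ℝ}
    (h : ∀ᶠ i in (U : Filter ι), f i ∈ Icc p q) :
    ∃ y ∈ Icc p q, Tendsto f U (𝓝 y) := by
  obtain ⟨y, hy, h2⟩ := (isCompact_Icc (a := p) (b := q)).ultrafilter_le_nhds' (U.map f) h
  exact ⟨y, hy, h2⟩

lemma exists_lt_mem {D : Set ℝ} (o : IsOpen D) {x : ℝ} (hx : x ∈ D) : ∃ y < x, y ∈ D := by
  have : ∀ᶠ y in 𝓝[<] x, y ∈ D := nhdsWithin_le_nhds (o.mem_nhds hx)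
  obtain ⟨y, h1, h2⟩ := (this.and self_mem_nhdsWithin).exists
  exact ⟨y, h2, h1⟩

lemma tendsto_F {P : Par} (g : Good P) {ι : Type*} {l : Filter ι} {f : ι → ℝ} {y : ℝ}
    (h : ∀ᶠ i in l, f i ∈ Icc 0 P.u) (hy : y ∈ Icc 0 P.u) (t : Tendsto f l (𝓝 y)) :
    Tendsto (fun i => P.F (f i)) l (𝓝 (P.F y)) := by
  rw [tendsto_iff_dist_tendsto_zero] at *
  have t2 : Tendsto (fun i => P.L * dist (f i) y) l (𝓝 0) := by simpa using t.const_mul P.L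
  refine squeeze_zero' (Eventually.of_forall fun _ => dist_nonneg) ?_ t2
  filter_upwards [h] with i hi
  exact g.lF _ hi _ hy

lemma compact_half {P : Par} (g : Good P) {ι : Type*} (U : Ultrafilter ι) {s : ι → ℝ}
    {D : ι → Set ℝ} {φ ψ φ1 ψ1 : ι → ℝ → ℝ} {s0 : ℝ} {D0 : Set ℝ}
    (h : ∀ᶠ i in (U : Filter ι), 0 ≤ s i ∧ MS P (s i) (D i) (φ i) (ψ i) (φ1 i) (ψ1 i))
    (hs : Tendsto s U (𝓝 s0)) (o : IsOpen D0) (up : IsUpperSet D0)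
    (hD : ∀ x ∈ D0, ∀ᶠ i in (U : Filter ι), x ∈ D i)
    {Φ Ψ Φ1 : ℝ → ℝ}
    (rΦ : ∀ x ∈ D0, Φ x ∈ Icc 0 P.u)
    (tφ : ∀ x ∈ D0, Tendsto (fun i => φ i x) U (𝓝 (Φ x)))
    (tψ : ∀ x ∈ D0, Tendsto (fun i => ψ i x) U (𝓝 (Ψ x)))
    (tφ1 : ∀ x ∈ D0, Tendsto (fun i => φ1 i x) U (𝓝 (Φ1 x))) :
    (∀ x ∈ D0, HasDerivAt Φ (Φ1 x) x) ∧
    (∀ x ∈ D0, HasDerivAt Φ1 ((s0 * Φ1 x + P.a * Φ x - P.b * Ψ x + P.F (Φ x)) / P.d1) x) ∧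
    MonotoneOn Φ D0 := by
  have hS : ∀ᶠ i in (U : Filter ι), s i ≤ s0 + 1 :=
    (hs.eventually (gt_mem_nhds (by linarith : s0 < s0 + 1))).mono fun _ h => h.le
  refine ⟨?_, ?_, ?_⟩
  · intro x hx
    obtain ⟨x0, h0, hx0⟩ := exists_lt_mem o hx
    have hD0 := hD x0 hx0
    refine hasDeriv_lim (f := φ) (g := φ1) (C := P.C2 (s0 + 1)) h0 ?_ ?_
      (fun y hy => tφ y (up hy.le hx0)) (tφ1 x hx)
    · filter_upwards [h, hD0] with i hi h2 y hy
      exact hi.2.hφ y (hi.2.up hy.le h2)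
    · filter_upwards [h, hD0, hS] with i hi h2 h3 y hy z hz
      exact hi.2.φ1_lip g hi.1 h3 (hi.2.up hy.le h2) (hi.2.up hz.le h2)
  · intro x hx
    obtain ⟨x0, h0, hx0⟩ := exists_lt_mem o hx
    have hD0 := hD x0 hx0
    refine hasDeriv_lim (f := φ1)
      (g := fun i x => (s i * φ1 i x + P.a * φ i x - P.b * ψ i x + P.F (φ i x)) / P.d1)
      (C := P.C3 (s0 + 1)) h0 ?_ ?_
      (fun y hy => tφ1 y (up hy.le hx0)) ?_
    · filter_upwards [h, hD0] with i hi h2 y hy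
      exact hi.2.hφ1 y (hi.2.up hy.le h2)
    · filter_upwards [h, hD0, hS] with i hi h2 h3 y hy z hz
      exact hi.2.φ2_lip g hi.1 h3 (hi.2.up hy.le h2) (hi.2.up hz.le h2)
    · refine Tendsto.div_const ?_ _
      refine ((((hs.mul (tφ1 x hx))).add ((tφ x hx).const_mul _)).sub
        ((tψ x hx).const_mul _)).add (tendsto_F g ?_ (rΦ x hx) (tφ x hx))
      filter_upwards [h, hD x hx] with i hi h2
      exact hi.2.rφ x h2
  · intro x hx y hy hxy
    refine le_of_tendsto_of_tendsto (tφ x hx) (tφ y hy) ?_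
    filter_upwards [h, hD x hx] with i hi h2
    exact hi.2.mφ h2 (hi.2.up hxy h2) hxy

lemma compact {P : Par} (g : Good P) {ι : Type*} (U : Ultrafilter ι) {s : ι → ℝ}
    {D : ι → Set ℝ} {φ ψ φ1 ψ1 : ι → ℝ → ℝ} {s0 : ℝ} {D0 : Set ℝ}
    (h : ∀ᶠ i in (U : Filter ι), 0 ≤ s i ∧ MS P (s i) (D i) (φ i) (ψ i) (φ1 i) (ψ1 i))
    (hs : Tendsto s U (𝓝 s0)) (o : IsOpen D0) (up : IsUpperSet D0)
    (hD : ∀ x ∈ D0, ∀ᶠ i in (U : Filter ι), x ∈ D i) :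
    ∃ Φ Ψ Φ1 Ψ1 : ℝ → ℝ, MS P s0 D0 Φ Ψ Φ1 Ψ1 ∧
      (∀ x ∈ D0, Tendsto (fun i => φ i x) U (𝓝 (Φ x))) ∧
      (∀ x ∈ D0, Tendsto (fun i => ψ i x) U (𝓝 (Ψ x))) ∧
      (∀ x ∈ D0, Tendsto (fun i => φ1 i x) U (𝓝 (Φ1 x))) ∧
      (∀ x ∈ D0, Tendsto (fun i => ψ1 i x) U (𝓝 (Ψ1 x))) := by
  have e1 : ∀ x, ∃ y, x ∈ D0 → y ∈ Icc 0 P.u ∧ Tendsto (fun i => φ i x) U (𝓝 y) := by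
    intro x
    by_cases hx : x ∈ D0
    · obtain ⟨y, h1, h2⟩ := ulim U (f := fun i => φ i x) (p := 0) (q := P.u) (by
        filter_upwards [h, hD x hx] with i hi h2
        exact hi.2.rφ x h2)
      exact ⟨y, fun _ => ⟨h1, h2⟩⟩
    · exact ⟨0, fun h => absurd h hx⟩
  have e2 : ∀ x, ∃ y, x ∈ D0 → y ∈ Icc 0 P.v ∧ Tendsto (fun i => ψ i x) U (𝓝 y) := by
    intro x
    by_cases hx : x ∈ D0
    · obtain ⟨y, h1, h2⟩ := ulim U (f := fun i => ψ i x) (p := 0) (q := P.v) (by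
        filter_upwards [h, hD x hx] with i hi h2
        exact hi.2.rψ x h2)
      exact ⟨y, fun _ => ⟨h1, h2⟩⟩
    · exact ⟨0, fun h => absurd h hx⟩
  have e3 : ∀ x, ∃ y, x ∈ D0 → Tendsto (fun i => φ1 i x) U (𝓝 y) := by
    intro x
    by_cases hx : x ∈ D0
    · obtain ⟨y, h1, h2⟩ := ulim U (f := fun i => φ1 i x) (p := 0) (q := P.C1) (by
        filter_upwards [h, hD x hx] with i hi h2
        exact ⟨hi.2.φ1_nn h2, hi.2.φ1_le g hi.1 h2⟩)
      exact ⟨y, fun _ => h2⟩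
    · exact ⟨0, fun h => absurd h hx⟩
  have e4 : ∀ x, ∃ y, x ∈ D0 → Tendsto (fun i => ψ1 i x) U (𝓝 y) := by
    intro x
    by_cases hx : x ∈ D0
    · obtain ⟨y, h1, h2⟩ := ulim U (f := fun i => ψ1 i x) (p := 0) (q := P.swap.C1) (by
        filter_upwards [h, hD x hx] with i hi h2
        exact ⟨hi.2.swap.φ1_nn h2, hi.2.swap.φ1_le g.swap hi.1 h2⟩)
      exact ⟨y, fun _ => h2⟩
    · exact ⟨0, fun h => absurd h hx⟩
  choose Φ hΦ using e1
  choose Ψ hΨ using e2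
  choose Φ1 hΦ1 using e3
  choose Ψ1 hΨ1 using e4
  obtain ⟨a1, a2, a3⟩ := compact_half g U h hs o up hD (fun x hx => (hΦ x hx).1)
    (fun x hx => (hΦ x hx).2) (fun x hx => (hΨ x hx).2) hΦ1
  obtain ⟨b1, b2, b3⟩ := compact_half g.swap U (h.mono fun i hi => ⟨hi.1, hi.2.swap⟩) hs o up hD
    (fun x hx => (hΨ x hx).1)
    (fun x hx => (hΨ x hx).2) (fun x hx => (hΦ x hx).2) hΨ1
  exact ⟨Φ, Ψ, Φ1, Ψ1, ⟨o, up, a1, b1, a2, b2, a3, b3, fun x hx => (hΦ x hx).1,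
    fun x hx => (hΨ x hx).1⟩, fun x hx => (hΦ x hx).2, fun x hx => (hΨ x hx).2, hΦ1, hΨ1⟩

lemma Good.Fk {P : Par} (g : Good P) {k z : ℝ} (hk : 1 < k) (hz : 0 < z) :
    k * P.F z < P.F (k * z) := by
  have hkz : z < k * z := by nlinarith
  have := g.rF (mem_Ioi.2 hz) (mem_Ioi.2 (hz.trans hkz)) hkz
  simp only at this
  rw [div_lt_div_iff₀ hz (hz.trans hkz)] at this
  nlinarith

lemma Good.equil {P : Par} (g : Good P) {l m : ℝ} (hl : l ∈ Icc 0 P.u) (hm : m ∈ Icc 0 P.v)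
    (h1 : P.a * l - P.b * m + P.F l = 0) (h2 : P.d * m - P.c * l + P.G m = 0) :
    (l = 0 ∧ m = 0) ∨ (l = P.u ∧ m = P.v) := by
  have hb := g.b
  have hc := g.c
  rcases eq_or_lt_of_le hl.1 with h0 | h0
  · left
    subst h0
    rw [g.F0] at h1
    refine ⟨rfl, ?_⟩
    have : P.b * m = 0 := by linarith
    rcases mul_eq_zero.1 this with h | h
    · linarith
    · exact h
  have hm0 : 0 < m := by
    rcases eq_or_lt_of_le hm.1 with h | h
    · rw [← h, g.G0] at h2; nlinarith
    · exact h
  right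
  have hlu : l = P.u := by
    by_contra hne
    have hlt : l < P.u := lt_of_le_of_ne hl.2 hne
    have r1 := g.rF (mem_Ioi.2 h0) (mem_Ioi.2 g.u) hlt
    have r2 : P.G m / m ≤ P.G P.v / P.v :=
      g.rG.monotoneOn (mem_Ioi.2 hm0) (mem_Ioi.2 g.v) hm.2
    simp only at r1 r2
    rw [div_lt_div_iff₀ h0 g.u] at r1
    rw [div_le_div_iff₀ hm0 g.v] at r2
    have q1 : P.F l = P.b * m - P.a * l := by linarith
    have q2 : P.G m = P.c * l - P.d * m := by linarith
    have q3 : P.F P.u = P.b * P.v - P.a * P.u := by linarith [g.e1]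
    have q4 : P.G P.v = P.c * P.u - P.d * P.v := by linarith [g.e2]
    rw [q1, q3] at r1
    rw [q2, q4] at r2
    have r1' : P.b * (m * P.u) < P.b * (P.v * l) := by linarith
    have r2' : P.c * (l * P.v) ≤ P.c * (P.u * m) := by linarith
    have := lt_of_mul_lt_mul_left r1' hb.le
    have := le_of_mul_le_mul_left r2' hc
    linarith
  refine ⟨hlu, ?_⟩
  rw [hlu] at h1
  have : P.b * m = P.b * P.v := by linarith [g.e1]
  exact mul_left_cancel₀ hb.ne' this

lemma MS.const_equil {P : Par} (g : Good P) {s l m : ℝ} {D : Set ℝ} {φ ψ φ1 ψ1 : ℝ → ℝ}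
    (h : MS P s D φ ψ φ1 ψ1) {O : Set ℝ} (hO : IsOpen O) (hOD : O ⊆ D) {x : ℝ} (hx : x ∈ O)
    (h1 : ∀ y ∈ O, φ y = l) :
    φ1 x = 0 ∧ P.a * l - P.b * ψ x + P.F l = 0 := by
  have k1 : ∀ y ∈ O, φ1 y = 0 := by
    intro y hy
    have e : φ =ᶠ[𝓝 y] fun _ => l := by
      filter_upwards [hO.mem_nhds hy] with z hz using h1 z hz
    exact ((h.hφ y (hOD hy)).congr_of_eventuallyEq e.symm).unique (hasDerivAt_const y l)
  have k2 : (s * φ1 x + P.a * φ x - P.b * ψ x + P.F (φ x)) / P.d1 = 0 := by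
    have e : φ1 =ᶠ[𝓝 x] fun _ => 0 := by
      filter_upwards [hO.mem_nhds hx] with z hz using k1 z hz
    exact ((h.hφ1 x (hOD hx)).congr_of_eventuallyEq e.symm).unique (hasDerivAt_const x 0)
  rw [k1 x hx, h1 x hx, div_eq_zero_iff] at k2
  refine ⟨k1 x hx, ?_⟩
  rcases k2 with h | h
  · linarith
  · exact absurd h g.d1.ne'

lemma MS.lim_equil {P : Par} (g : Good P) {s l m : ℝ} (hs : 0 ≤ s) {D : Set ℝ}
    {φ ψ φ1 ψ1 : ℝ → ℝ}
    (h : MS P s D φ ψ φ1 ψ1) {f : Filter ℝ} [NeBot f]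
    (hf : ∀ x, Tendsto (fun t => x + t) f f) (hfD : ∀ᶠ x in f, x ∈ D)
    (hl : Tendsto φ f (𝓝 l)) (hm : Tendsto ψ f (𝓝 m)) :
    (l = 0 ∧ m = 0) ∨ (l = P.u ∧ m = P.v) := by
  let U : Ultrafilter ℝ := Ultrafilter.of f
  have hU : (U : Filter ℝ) ≤ f := Ultrafilter.of_le f
  obtain ⟨Φ, Ψ, Φ1, Ψ1, hM, t1, t2, -, -⟩ := compact g U (s := fun _ => s) (s0 := s)
    (D0 := univ) (Eventually.of_forall fun t => ⟨hs, h.shift t⟩) tendsto_const_nhds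
    isOpen_univ isUpperSet_univ
    (fun x _ => hU ((hf x).eventually hfD))
  have c1 : ∀ x, Φ x = l := fun x =>
    tendsto_nhds_unique (t1 x (mem_univ x)) ((hl.comp (hf x)).mono_left hU)
  have c2 : ∀ x, Ψ x = m := fun x =>
    tendsto_nhds_unique (t2 x (mem_univ x)) ((hm.comp (hf x)).mono_left hU)
  have k1 := (hM.const_equil g (m := m) isOpen_univ (subset_univ _) (mem_univ 0) (fun y _ => c1 y)).2
  have k2 := (hM.swap.const_equil g.swap (m := l) isOpen_univ (subset_univ _) (mem_univ 0)
    (fun y _ => c2 y)).2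
  rw [c2] at k1
  rw [c1] at k2
  refine g.equil ?_ ?_ k1 k2
  · rw [← c1 0]; exact hM.rφ 0 (mem_univ _)
  · rw [← c2 0]; exact hM.rψ 0 (mem_univ _)

lemma tendsto_of_mono_top {D : Set ℝ} (up : IsUpperSet D) {x0 : ℝ} (hx0 : x0 ∈ D) {φ : ℝ → ℝ}
    {q : ℝ} (m : MonotoneOn φ D) (r : ∀ x ∈ D, φ x ≤ q) :
    ∃ l, Tendsto φ atTop (𝓝 l) ∧ ∀ x ∈ D, φ x ≤ l := by
  have hm : Monotone (fun x => φ (max x x0)) := by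
    intro x y hxy
    exact m (up (le_max_right _ _) hx0) (up (le_max_right _ _) hx0) (max_le_max hxy le_rfl)
  have hb : BddAbove (range (fun x => φ (max x x0))) := by
    refine ⟨q, ?_⟩
    rintro _ ⟨x, rfl⟩
    exact r _ (up (le_max_right _ _) hx0)
  have ht := tendsto_atTop_ciSup hm hb
  have ht2 : Tendsto φ atTop (𝓝 (⨆ x, φ (max x x0))) := by
    refine ht.congr' ?_
    filter_upwards [eventually_ge_atTop x0] with x hx
    rw [max_eq_left hx]
  refine ⟨_, ht2, fun x hx => ?_⟩
  refine ge_of_tendsto ht2 ?_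
  filter_upwards [eventually_ge_atTop x] with y hy
  exact m hx (up hy hx) hy

lemma MS.lim_top {P : Par} (g : Good P) {s : ℝ} (hs : 0 ≤ s) {D : Set ℝ}
    {φ ψ φ1 ψ1 : ℝ → ℝ}
    (h : MS P s D φ ψ φ1 ψ1) {x0 : ℝ} (hx0 : x0 ∈ D) (hp : 0 < φ x0) :
    Tendsto φ atTop (𝓝 P.u) ∧ Tendsto ψ atTop (𝓝 P.v) := by
  obtain ⟨l, hl, hl2⟩ := tendsto_of_mono_top h.up hx0 h.mφ (fun x hx => (h.rφ x hx).2)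
  obtain ⟨m, hm, hm2⟩ := tendsto_of_mono_top h.up hx0 h.mψ (fun x hx => (h.rψ x hx).2)
  have := h.lim_equil g hs (f := atTop) (fun x => tendsto_atTop_add_const_left _ x tendsto_id)
    ((eventually_ge_atTop x0).mono fun x hx => h.up hx hx0) hl hm
  rcases this with h1 | h1
  · have := hl2 x0 hx0
    linarith [h1.1]
  · rw [← h1.1, ← h1.2]; exact ⟨hl, hm⟩

lemma MS.lim_bot {P : Par} (g : Good P) {s : ℝ} (hs : 0 ≤ s)
    {φ ψ φ1 ψ1 : ℝ → ℝ}
    (h : MS P s univ φ ψ φ1 ψ1) {x0 : ℝ} (hp : φ x0 < P.u) :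
    Tendsto φ atBot (𝓝 0) ∧ Tendsto ψ atBot (𝓝 0) := by
  have m1 : Monotone φ := monotoneOn_univ.1 h.mφ
  have m2 : Monotone ψ := monotoneOn_univ.1 h.mψ
  have hl := tendsto_atBot_ciInf m1 ⟨0, by rintro _ ⟨x, rfl⟩; exact (h.rφ x trivial).1⟩
  have hm := tendsto_atBot_ciInf m2 ⟨0, by rintro _ ⟨x, rfl⟩; exact (h.rψ x trivial).1⟩
  have := h.lim_equil g hs (f := atBot) (fun x => tendsto_atBot_add_const_left _ x tendsto_id)
    (Eventually.of_forall fun x => mem_univ x) hl hm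
  rcases this with h1 | h1
  · rw [h1.1] at hl
    rw [h1.2] at hm
    exact ⟨hl, hm⟩
  · have : (⨅ i, φ i) ≤ φ x0 :=
      ciInf_le ⟨0, by rintro _ ⟨x, rfl⟩; exact (h.rφ x trivial).1⟩ x0
    linarith [h1.1]

lemma gron_aux {E E' : ℝ → ℝ} {D : Set ℝ} (o : IsOpen D) (up : IsUpperSet D) {C : ℝ}
    (h : ∀ x ∈ D, HasDerivAt E (E' x) x) (hC : ∀ x ∈ D, |E' x| ≤ C * E x) {x y : ℝ}
    (hx : x ∈ D) (hy : y ∈ D) (hxy : x ≤ y) :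
    E y * Real.exp (-C * y) ≤ E x * Real.exp (-C * x) ∧
    E x * Real.exp (C * x) ≤ E y * Real.exp (C * y) := by
  have hc : Convex ℝ D := up.ordConnected.convex
  have hd : ∀ K : ℝ, ∀ x ∈ D, HasDerivAt (fun x => E x * Real.exp (K * x))
      (E' x * Real.exp (K * x) + E x * (Real.exp (K * x) * K)) x := by
    intro K x hx
    have := ((hasDerivAt_id x).const_mul K).exp
    simp only [id, mul_one] at this
    exact (h x hx).mul this
  constructor
  · refine antitoneOn_of_deriv_nonpos hc
      (fun z hz => (hd (-C) z hz).continuousAt.continuousWithinAt)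
      (fun z hz => (hd (-C) z (interior_subset hz)).differentiableAt.differentiableWithinAt) ?_
      hx hy hxy
    intro z hz
    have hz := interior_subset hz
    rw [(hd (-C) z hz).deriv]
    have := (abs_le.1 (hC z hz)).2
    have e := Real.exp_pos (-C * z)
    nlinarith
  · refine monotoneOn_of_deriv_nonneg hc
      (fun z hz => (hd C z hz).continuousAt.continuousWithinAt)
      (fun z hz => (hd C z (interior_subset hz)).differentiableAt.differentiableWithinAt) ?_
      hx hy hxy
    intro z hz
    have hz := interior_subset hz
    rw [(hd C z hz).deriv]
    have := (abs_le.1 (hC z hz)).1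
    have e := Real.exp_pos (C * z)
    nlinarith

lemma en_half {s a b L d1 X Y Z W : ℝ} (hs : 0 ≤ s) (ha : 0 < a) (hb : 0 < b) (hL : 0 ≤ L)
    (hd : 0 < d1) (hW : |W| ≤ L * |X|) :
    |2 * X * Y + 2 * Y * ((s * Y + a * X - b * Z + W) / d1)| ≤
      (1 + (2 * s + a + b + L) / d1) * (X ^ 2 + Y ^ 2 + Z ^ 2) := by
  have t : ∀ p q : ℝ, |2 * p * q| ≤ p ^ 2 + q ^ 2 := by
    intro p q
    rw [abs_le]; constructor <;> nlinarith [sq_nonneg (p + q), sq_nonneg (p - q)]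
  have h1 : |2 * s * Y * Y| ≤ 2 * s * (X ^ 2 + Y ^ 2 + Z ^ 2) := by
    rw [abs_of_nonneg (by nlinarith [mul_nonneg hs (mul_self_nonneg Y)])]
    nlinarith [mul_nonneg hs (sq_nonneg X), mul_nonneg hs (sq_nonneg Z)]
  have h2 : |a * (2 * Y * X)| ≤ a * (X ^ 2 + Y ^ 2 + Z ^ 2) := by
    rw [abs_mul, abs_of_pos ha]
    exact mul_le_mul_of_nonneg_left ((t Y X).trans (by nlinarith [sq_nonneg Z])) ha.le
  have h3 : |b * (2 * Y * Z)| ≤ b * (X ^ 2 + Y ^ 2 + Z ^ 2) := by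
    rw [abs_mul, abs_of_pos hb]
    exact mul_le_mul_of_nonneg_left ((t Y Z).trans (by nlinarith [sq_nonneg X])) hb.le
  have h4 : |2 * Y * W| ≤ L * (X ^ 2 + Y ^ 2 + Z ^ 2) := by
    have e1 : |2 * Y * W| ≤ L * |2 * Y * X| := by
      rw [abs_mul, abs_mul (2 * Y) X]
      calc |2 * Y| * |W| ≤ |2 * Y| * (L * |X|) := mul_le_mul_of_nonneg_left hW (abs_nonneg _)
        _ = _ := by ring
    exact e1.trans (mul_le_mul_of_nonneg_left ((t Y X).trans (by nlinarith [sq_nonneg Z])) hL)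
  have h5 : |2 * Y * (s * Y + a * X - b * Z + W)| ≤
      (2 * s + a + b + L) * (X ^ 2 + Y ^ 2 + Z ^ 2) := by
    rw [abs_le] at *
    constructor <;> nlinarith [h1.1, h1.2, h2.1, h2.2, h3.1, h3.2, h4.1, h4.2]
  have h6 : |2 * Y * ((s * Y + a * X - b * Z + W) / d1)| ≤
      ((2 * s + a + b + L) / d1) * (X ^ 2 + Y ^ 2 + Z ^ 2) := by
    rw [← mul_div_assoc, abs_div, abs_of_pos hd, div_mul_eq_mul_div]
    exact div_le_div_of_nonneg_right h5 hd.le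
  have h7 := t X Y
  refine (abs_add_le _ _).trans ?_
  nlinarith [sq_nonneg Z]

lemma MS.energy {P : Par} (g : Good P) {s l m : ℝ} (hs : 0 ≤ s) {D : Set ℝ}
    {φ ψ φ1 ψ1 : ℝ → ℝ} (h : MS P s D φ ψ φ1 ψ1)
    (hl : l ∈ Icc 0 P.u) (hm : m ∈ Icc 0 P.v)
    (h1 : P.a * l - P.b * m + P.F l = 0) (h2 : P.d * m - P.c * l + P.G m = 0) :
    ∃ C : ℝ, ∃ E' : ℝ → ℝ, (∀ x ∈ D, HasDerivAt
        (fun x => (φ x - l) ^ 2 + φ1 x ^ 2 + (ψ x - m) ^ 2 + ψ1 x ^ 2) (E' x) x) ∧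
      ∀ x ∈ D, |E' x| ≤ C * ((φ x - l) ^ 2 + φ1 x ^ 2 + (ψ x - m) ^ 2 + ψ1 x ^ 2) := by
  refine ⟨(1 + (2 * s + P.a + P.b + P.L) / P.d1) + (1 + (2 * s + P.d + P.c + P.L) / P.d2),
    fun x => (2 * (φ x - l) * φ1 x + 2 * φ1 x * ((s * φ1 x + P.a * (φ x - l) - P.b * (ψ x - m)
      + (P.F (φ x) - P.F l)) / P.d1)) + (2 * (ψ x - m) * ψ1 x +
      2 * ψ1 x * ((s * ψ1 x + P.d * (ψ x - m) - P.c * (φ x - l)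
      + (P.G (ψ x) - P.G m)) / P.d2)), ?_, ?_⟩
  · intro x hx
    have k1 := ((h.hφ x hx).sub_const l).pow 2
    have k2 := (h.hφ1 x hx).pow 2
    have k3 := ((h.hψ x hx).sub_const m).pow 2
    have k4 := (h.hψ1 x hx).pow 2
    refine (((k1.add k2).add k3).add k4).congr_deriv ?_
    have e1 : s * φ1 x + P.a * (φ x - l) - P.b * (ψ x - m) + (P.F (φ x) - P.F l) =
      s * φ1 x + P.a * φ x - P.b * ψ x + P.F (φ x) := by linarith
    have e2 : s * ψ1 x + P.d * (ψ x - m) - P.c * (φ x - l) + (P.G (ψ x) - P.G m) =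
      s * ψ1 x + P.d * ψ x - P.c * φ x + P.G (ψ x) := by linarith
    beta_reduce
    rw [e1, e2]
    push_cast
    ring
  · intro x hx
    have k1 := en_half (Y := φ1 x) (Z := ψ x - m) hs g.a g.b g.L g.d1 (g.lF _ (h.rφ x hx) _ hl)
    have k2 := en_half (Y := ψ1 x) (Z := φ x - l) hs g.d g.c g.L g.d2 (g.lG _ (h.rψ x hx) _ hm)
    refine (abs_add_le _ _).trans ?_
    have p1 : 0 ≤ 1 + (2 * s + P.a + P.b + P.L) / P.d1 := by
      have := g.a; have := g.b; have := g.L; have := g.d1; positivity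
    have p2 : 0 ≤ 1 + (2 * s + P.d + P.c + P.L) / P.d2 := by
      have := g.c; have := g.d; have := g.L; have := g.d2; positivity
    have := mul_nonneg p1 (sq_nonneg (ψ1 x))
    have := mul_nonneg p2 (sq_nonneg (φ1 x))
    linarith

lemma MS.uniq {P : Par} (g : Good P) {s l m : ℝ} (hs : 0 ≤ s) {D : Set ℝ}
    {φ ψ φ1 ψ1 : ℝ → ℝ} (h : MS P s D φ ψ φ1 ψ1)
    (hl : l ∈ Icc 0 P.u) (hm : m ∈ Icc 0 P.v)
    (h1 : P.a * l - P.b * m + P.F l = 0) (h2 : P.d * m - P.c * l + P.G m = 0)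
    {x0 : ℝ} (hx0 : x0 ∈ D) (i1 : φ x0 = l) (i2 : ψ x0 = m) (i3 : φ1 x0 = 0) (i4 : ψ1 x0 = 0) :
    ∀ x ∈ D, φ x = l ∧ ψ x = m := by
  obtain ⟨C, E', hE, hC⟩ := h.energy g hs hl hm h1 h2
  intro x hx
  have hz : (φ x - l) ^ 2 + φ1 x ^ 2 + (ψ x - m) ^ 2 + ψ1 x ^ 2 ≤ 0 := by
    rcases le_total x0 x with hh | hh
    · have := (gron_aux h.op h.up hE hC hx0 hx hh).1
      simp only [i1, i2, i3, i4, sub_self] at this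
      have e := Real.exp_pos (-C * x)
      norm_num at this
      by_contra hne
      push Not at hne
      have := mul_pos hne e
      simp only [neg_mul] at this
      linarith
    · have := (gron_aux h.op h.up hE hC hx hx0 hh).2
      simp only [i1, i2, i3, i4, sub_self] at this
      have e := Real.exp_pos (C * x)
      norm_num at this
      by_contra hne
      push Not at hne
      have := mul_pos hne e
      linarith
  have a1 := sq_nonneg (φ x - l)
  have a2 := sq_nonneg (ψ x - m)
  have a3 := sq_nonneg (φ1 x)
  have a4 := sq_nonneg (ψ1 x)
  constructor
  · have : φ x - l = 0 := pow_eq_zero_iff (two_ne_zero) |>.1 (by linarith)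
    linarith
  · have : ψ x - m = 0 := pow_eq_zero_iff (two_ne_zero) |>.1 (by linarith)
    linarith

lemma Good.zero_eq {P : Par} (g : Good P) :
    P.a * 0 - P.b * 0 + P.F 0 = 0 ∧ P.d * 0 - P.c * 0 + P.G 0 = 0 := by
  rw [g.F0, g.G0]; simp

lemma MS.uniq0 {P : Par} (g : Good P) {s : ℝ} (hs : 0 ≤ s)
    {φ ψ φ1 ψ1 : ℝ → ℝ} (h : MS P s (Ioi 0) φ ψ φ1 ψ1)
    (i1 : Tendsto φ (𝓝[>] 0) (𝓝 0)) (i2 : Tendsto ψ (𝓝[>] 0) (𝓝 0))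
    (i3 : Tendsto φ1 (𝓝[>] 0) (𝓝 0)) (i4 : Tendsto ψ1 (𝓝[>] 0) (𝓝 0)) :
    ∀ x > 0, φ x = 0 := by
  obtain ⟨C, E', hE, hC⟩ := h.energy g hs (l := 0) (m := 0) ⟨le_rfl, g.u.le⟩ ⟨le_rfl, g.v.le⟩
    g.zero_eq.1 g.zero_eq.2
  intro x hx
  have t : Tendsto (fun y => ((φ y - 0) ^ 2 + φ1 y ^ 2 + (ψ y - 0) ^ 2 + ψ1 y ^ 2) *
      Real.exp (-C * y)) (𝓝[>] 0) (𝓝 0) := by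
    have e : Tendsto (fun y => Real.exp (-C * y)) (𝓝[>] (0:ℝ)) (𝓝 (Real.exp (-C * 0))) :=
      (Continuous.tendsto (by fun_prop) 0).mono_left nhdsWithin_le_nhds
    have := (((((i1.sub_const 0).pow 2).add (i3.pow 2)).add ((i2.sub_const 0).pow 2)).add
      (i4.pow 2)).mul e
    simpa using this
  have hz : ((φ x - 0) ^ 2 + φ1 x ^ 2 + (ψ x - 0) ^ 2 + ψ1 x ^ 2) * Real.exp (-C * x) ≤ 0 := by
    refine ge_of_tendsto t ?_
    have : ∀ᶠ y in 𝓝[>] (0:ℝ), y < x := nhdsWithin_le_nhds (gt_mem_nhds hx)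
    filter_upwards [this, self_mem_nhdsWithin] with y hy hy0
    exact (gron_aux h.op h.up hE hC hy0 hx hy.le).1
  have hz2 : (φ x - 0) ^ 2 + φ1 x ^ 2 + (ψ x - 0) ^ 2 + ψ1 x ^ 2 ≤ 0 := by
    by_contra hne
    push Not at hne
    have := mul_pos hne (Real.exp_pos (-C * x))
    linarith
  have a1 := sq_nonneg (φ x - 0)
  have a2 := sq_nonneg (ψ x - 0)
  have a3 := sq_nonneg (φ1 x)
  have a4 := sq_nonneg (ψ1 x)
  have : φ x - 0 = 0 := pow_eq_zero_iff (two_ne_zero) |>.1 (by linarith)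
  linarith

lemma MS.flat {P : Par} (g : Good P) {s : ℝ} (hs : 0 ≤ s) {D : Set ℝ}
    {φ ψ φ1 ψ1 : ℝ → ℝ} (h : MS P s D φ ψ φ1 ψ1) {x y : ℝ} (hx : x ∈ D)
    (hxy : x < y) (e : φ x = φ y) :
    (∀ z ∈ D, φ z = 0 ∧ ψ z = 0) ∨ (∀ z ∈ D, φ z = P.u ∧ ψ z = P.v) := by
  have hO : Ioo x y ⊆ D := fun z hz => h.up hz.1.le hx
  have hy : y ∈ D := h.up hxy.le hx
  have c1 : ∀ z ∈ Ioo x y, φ z = φ x := by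
    intro z hz
    have h1 := h.mφ hx (hO hz) hz.1.le
    have h2 := h.mφ (hO hz) hy hz.2.le
    linarith
  have k1 : ∀ z ∈ Ioo x y, φ1 z = 0 ∧ P.a * φ x - P.b * ψ z + P.F (φ x) = 0 := fun z hz =>
    h.const_equil g (m := 0) isOpen_Ioo hO hz c1
  obtain ⟨z0, hz0⟩ : (Ioo x y).Nonempty := nonempty_Ioo.2 hxy
  have c2 : ∀ z ∈ Ioo x y, ψ z = ψ z0 := by
    intro z hz
    have h1 := (k1 z hz).2
    have h2 := (k1 z0 hz0).2
    exact mul_left_cancel₀ g.b.ne' (by linarith)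
  have k2 := h.swap.const_equil g.swap (m := 0) isOpen_Ioo hO hz0 c2
  have k3 := k1 z0 hz0
  have rz := c1 z0 hz0
  have r1 := h.rφ z0 (hO hz0)
  have r2 := h.rψ z0 (hO hz0)
  rw [← rz] at k3
  have := h.uniq g hs r1 r2 k3.2 k2.2 (hO hz0) rfl rfl k3.1 k2.1
  rcases g.equil r1 r2 k3.2 k2.2 with hh | hh
  · left; rw [hh.1, hh.2] at this; exact this
  · right; rw [hh.1, hh.2] at this; exact this

lemma MS.strict {P : Par} (g : Good P) {s : ℝ} (hs : 0 ≤ s) {D : Set ℝ}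
    {φ ψ φ1 ψ1 : ℝ → ℝ} (h : MS P s D φ ψ φ1 ψ1) {x1 x2 : ℝ} (hx1 : x1 ∈ D) (hx2 : x2 ∈ D)
    (h1 : 0 < φ x1) (h2 : φ x2 < P.u) : StrictMonoOn φ D ∧ StrictMonoOn ψ D := by
  constructor
  · intro x hx y hy hxy
    refine lt_of_le_of_ne (h.mφ hx hy hxy.le) fun e => ?_
    rcases h.flat g hs hx hxy e with k | k
    · exact h1.ne' (k x1 hx1).1
    · exact h2.ne (k x2 hx2).1
  · intro x hx y hy hxy
    refine lt_of_le_of_ne (h.mψ hx hy hxy.le) fun e => ?_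
    rcases h.swap.flat g.swap hs hx hxy e with k | k
    · exact h1.ne' (k x1 hx1).2
    · exact h2.ne (k x2 hx2).2

lemma MS.posD {P : Par} (g : Good P) {s : ℝ} (hs : 0 ≤ s) {D : Set ℝ}
    {φ ψ φ1 ψ1 : ℝ → ℝ} (h : MS P s D φ ψ φ1 ψ1) {x1 x2 : ℝ} (hx1 : x1 ∈ D) (hx2 : x2 ∈ D)
    (h1 : 0 < φ x1) (h2 : φ x2 < P.u) : ∀ x ∈ D, 0 < φ x ∧ 0 < ψ x := by
  intro x hx
  obtain ⟨m1, m2⟩ := h.strict g hs hx1 hx2 h1 h2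
  obtain ⟨y, hy, hyD⟩ := exists_lt_mem h.op hx
  exact ⟨(h.rφ y hyD).1.trans_lt (m1 hyD hx hy), (h.rψ y hyD).1.trans_lt (m2 hyD hx hy)⟩

lemma second_test {w w1 : ℝ → ℝ} {w2 x0 : ℝ} (hmin : IsLocalMin w x0)
    (h : ∀ᶠ y in 𝓝 x0, HasDerivAt w (w1 y) y) (h2 : HasDerivAt w1 w2 x0) :
    w1 x0 = 0 ∧ 0 ≤ w2 := by
  have h0 : w1 x0 = 0 := hmin.hasDerivAt_eq_zero h.self_of_nhds
  refine ⟨h0, ?_⟩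
  by_contra hneg
  push Not at hneg
  have hs := hasDerivAt_iff_tendsto_slope.1 h2
  have hs' : ∀ᶠ y in 𝓝[>] x0, slope w1 x0 y < 0 :=
    (hs.mono_left (nhdsWithin_mono _ (fun y hy => ne_of_gt hy))).eventually (gt_mem_nhds hneg)
  have hall : ∀ᶠ y in 𝓝[>] x0, slope w1 x0 y < 0 ∧ HasDerivAt w (w1 y) y ∧ w x0 ≤ w y :=
    hs'.and ((h.filter_mono nhdsWithin_le_nhds).and (Eventually.filter_mono nhdsWithin_le_nhds hmin))
  obtain ⟨y, hy, hI⟩ := mem_nhdsGT_iff_exists_Ioc_subset.1 hall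
  have hy : x0 < y := hy
  obtain ⟨z, hz, he⟩ := exists_hasDerivAt_eq_slope w w1 hy
    (fun t ht => by
      rcases eq_or_lt_of_le ht.1 with e | e
      · rw [← e]; exact h.self_of_nhds.continuousAt.continuousWithinAt
      · exact (hI ⟨e, ht.2⟩).2.1.continuousAt.continuousWithinAt)
    (fun t ht => (hI ⟨ht.1, ht.2.le⟩).2.1)
  have a1 := (hI ⟨hz.1, hz.2.le⟩).1
  have a2 := (hI ⟨hy, le_rfl⟩).2.2
  rw [slope_def_field, h0, sub_zero] at a1
  have a3 : w1 z < 0 := by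
    rwa [div_lt_iff₀ (by linarith [hz.1]), zero_mul] at a1
  have a4 : 0 ≤ w1 z := by
    rw [he]; exact div_nonneg (by linarith) (by linarith)
  linarith

lemma contact {P : Par} (g : Good P) {s s' A : ℝ} (hss : s' ≤ s)
    {Φ Ψ Φ1 Ψ1 φ ψ φ1 ψ1 : ℝ → ℝ} (H : MS P s' (Ioi A) Φ Ψ Φ1 Ψ1)
    (h : MS P s (Ioi 0) φ ψ φ1 ψ1) (pos : ∀ x > A, 0 < Φ x)
    {k t : ℝ} (hk : 1 < k) (ht : A < t)
    (c1 : ∀ x > 0, φ x ≤ k * Φ (x + t)) (c2 : ∀ x > 0, ψ x ≤ k * Ψ (x + t))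
    {x0 : ℝ} (hx0 : 0 < x0) (e : φ x0 = k * Φ (x0 + t)) : False := by
  have hm : ∀ x > 0, x + t ∈ Ioi A := fun x hx => by
    simp only [mem_Ioi]; linarith
  have d1 : ∀ x > 0, HasDerivAt (fun x => k * Φ (x + t) - φ x) (k * Φ1 (x + t) - φ1 x) x :=
    fun x hx => (((H.hφ _ (hm x hx)).comp_add_const x t).const_mul k).sub (h.hφ x hx)
  have d2 := (((H.hφ1 _ (hm x0 hx0)).comp_add_const x0 t).const_mul k).sub (h.hφ1 x0 hx0)
  have hmin : IsLocalMin (fun x => k * Φ (x + t) - φ x) x0 := by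
    filter_upwards [lt_mem_nhds hx0] with x hx
    have := c1 x hx
    simp only [e, sub_self]; linarith
  obtain ⟨a1, a2⟩ := second_test (w1 := fun x => k * Φ1 (x + t) - φ1 x) hmin
    (by filter_upwards [lt_mem_nhds hx0] with x hx using d1 x hx) d2
  have b1 := c2 x0 hx0
  have b2 := g.Fk hk (pos _ (hm x0 hx0))
  have b3 := h.φ1_nn (mem_Ioi.2 hx0)
  rw [← e] at b2
  rw [← mul_div_assoc, ← sub_div] at a2
  have a3 := (le_div_iff₀ g.d1).1 a2
  have b4 := mul_le_mul_of_nonneg_left b1 g.b.le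
  have b5 := mul_nonneg (sub_nonneg.2 hss) b3
  have a1' : k * Φ1 (x0 + t) = φ1 x0 := by linarith
  have z1 : k * (s' * Φ1 (x0 + t)) = s' * φ1 x0 := by rw [← a1']; ring
  have z2 : k * (P.a * Φ (x0 + t)) = P.a * φ x0 := by rw [e]; ring
  nlinarith

lemma slide {P : Par} (g : Good P) {s s' A : ℝ} (hs' : 0 ≤ s') (hss : s' ≤ s)
    {Φ Ψ Φ1 Ψ1 φ ψ φ1 ψ1 : ℝ → ℝ} (H : MS P s' (Ioi A) Φ Ψ Φ1 Ψ1)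
    (h : MS P s (Ioi 0) φ ψ φ1 ψ1) (pos : ∀ x > A, 0 < Φ x ∧ 0 < Ψ x)
    (l1 : Tendsto Φ atTop (𝓝 P.u)) (l2 : Tendsto Ψ atTop (𝓝 P.v))
    (z1 : φ 0 = 0) (z2 : ψ 0 = 0)
    (q1 : ContinuousOn φ (Ici 0)) (q2 : ContinuousOn ψ (Ici 0))
    {k : ℝ} (hk : 1 < k) {t : ℝ} (ht : A < t) :
    ∀ x > 0, φ x ≤ k * Φ (x + t) ∧ ψ x ≤ k * Ψ (x + t) := by
  by_contra hbad
  let Gd : Set ℝ := {t' | A < t' ∧ ∀ x > 0, φ x ≤ k * Φ (x + t') ∧ ψ x ≤ k * Ψ (x + t')}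
  have up : ∀ p ∈ Gd, ∀ q, p ≤ q → q ∈ Gd := by
    intro p hp q hpq
    have hA := hp.1
    refine ⟨hA.trans_le hpq, fun x hx => ?_⟩
    have m1 : Φ (x + p) ≤ Φ (x + q) := H.mφ (by simp only [mem_Ioi]; linarith)
      (by simp only [mem_Ioi]; linarith) (by linarith)
    have m2 : Ψ (x + p) ≤ Ψ (x + q) := H.mψ (by simp only [mem_Ioi]; linarith)
      (by simp only [mem_Ioi]; linarith) (by linarith)
    exact ⟨(hp.2 x hx).1.trans (mul_le_mul_of_nonneg_left m1 (by linarith)),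
      (hp.2 x hx).2.trans (mul_le_mul_of_nonneg_left m2 (by linarith))⟩
  have big : ∃ R > t, ∀ y ≥ R, P.u ≤ k * Φ y ∧ P.v ≤ k * Ψ y := by
    have e1 : ∀ᶠ y in atTop, P.u < k * Φ y :=
      (l1.const_mul k).eventually (lt_mem_nhds (by nlinarith [g.u]))
    have e2 : ∀ᶠ y in atTop, P.v < k * Ψ y :=
      (l2.const_mul k).eventually (lt_mem_nhds (by nlinarith [g.v]))
    obtain ⟨R, hR⟩ := eventually_atTop.1 ((e1.and e2))
    exact ⟨max R (t + 1), lt_of_lt_of_le (by linarith) (le_max_right _ _), fun y hy =>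
      ⟨(hR y ((le_max_left _ _).trans hy)).1.le, (hR y ((le_max_left _ _).trans hy)).2.le⟩⟩
  obtain ⟨R, hRt, hR⟩ := big
  have hRG : R ∈ Gd := ⟨ht.trans hRt, fun x hx =>
    ⟨(h.rφ x hx).2.trans (hR _ (by linarith)).1, (h.rψ x hx).2.trans (hR _ (by linarith)).2⟩⟩
  have htG : t ∉ Gd := fun hh => hbad hh.2
  have hlb : ∀ p ∈ Gd, t ≤ p := by
    intro p hp
    by_contra hlt
    push Not at hlt
    exact htG (up p hp t hlt.le)
  have hbd : BddBelow Gd := ⟨t, hlb⟩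
  set t0 := sInf Gd with ht0
  have htt0 : t ≤ t0 := le_csInf ⟨R, hRG⟩ hlb
  have hAt0 : A < t0 := ht.trans_le htt0
  have hgt : ∀ p > t0, p ∈ Gd := by
    intro p hp
    obtain ⟨q, hq, hqp⟩ := exists_lt_of_csInf_lt ⟨R, hRG⟩ hp
    exact up q hq p hqp.le
  have hcont : ∀ x ≥ 0, ContinuousAt Φ (x + t0) ∧ ContinuousAt Ψ (x + t0) := by
    intro x hx
    have : x + t0 ∈ Ioi A := by simp only [mem_Ioi]; linarith
    exact ⟨(H.hφ _ this).continuousAt, (H.hψ _ this).continuousAt⟩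
  have t0G : t0 ∈ Gd := by
    refine ⟨hAt0, fun x hx => ?_⟩
    have tt : Tendsto (fun p => x + p) (𝓝[>] t0) (𝓝 (x + t0)) :=
      (Continuous.tendsto (by fun_prop) t0).mono_left nhdsWithin_le_nhds
    constructor
    · refine ge_of_tendsto (((hcont x hx.le).1.tendsto.comp tt).const_mul k) ?_
      filter_upwards [self_mem_nhdsWithin] with p hp using ((hgt p hp).2 x hx).1
    · refine ge_of_tendsto (((hcont x hx.le).2.tendsto.comp tt).const_mul k) ?_
      filter_upwards [self_mem_nhdsWithin] with p hp using ((hgt p hp).2 x hx).2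
  have nc1 : ∀ x ≥ 0, 0 < k * Φ (x + t0) - φ x := by
    intro x hx
    rcases eq_or_lt_of_le hx with e | e
    · rw [← e, z1, zero_add]
      have := mul_pos (by linarith : 0 < k) (pos t0 hAt0).1
      linarith
    · rcases eq_or_lt_of_le (t0G.2 x e).1 with e2 | e2
      · exact (contact g hss H h (fun x hx => (pos x hx).1) hk hAt0 (fun x hx => (t0G.2 x hx).1)
          (fun x hx => (t0G.2 x hx).2) e e2).elim
      · linarith
  have nc2 : ∀ x ≥ 0, 0 < k * Ψ (x + t0) - ψ x := by
    intro x hx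
    rcases eq_or_lt_of_le hx with e | e
    · rw [← e, z2, zero_add]
      have := mul_pos (by linarith : 0 < k) (pos t0 hAt0).2
      linarith
    · rcases eq_or_lt_of_le (t0G.2 x e).2 with e2 | e2
      · exact (contact g.swap hss H.swap h.swap (fun x hx => (pos x hx).2) hk hAt0
          (fun x hx => (t0G.2 x hx).2) (fun x hx => (t0G.2 x hx).1) e e2).elim
      · linarith
  have htlt : t < t0 := lt_of_le_of_ne htt0 (fun e => htG (e ▸ t0G))
  have hR0 : (0:ℝ) ≤ R - t := by linarith
  have low : ∀ (f f0 : ℝ → ℝ), (∀ x ≥ 0, ContinuousAt f (x + t0)) → ContinuousOn f0 (Ici 0) →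
      (∀ x ≥ 0, 0 < k * f (x + t0) - f0 x) →
      ∃ m > 0, ∀ x ∈ Icc 0 (R - t), m ≤ k * f (x + t0) - f0 x := by
    intro f f0 hf hf0 hp
    have hc : ContinuousOn (fun x => k * f (x + t0) - f0 x) (Icc 0 (R - t)) := by
      refine ContinuousOn.sub (ContinuousOn.mul continuousOn_const ?_)
        (hf0.mono (fun x hx => hx.1))
      intro x hx
      exact (ContinuousAt.comp (f := fun x => x + t0) (hf x hx.1) (by fun_prop)).continuousWithinAt
    obtain ⟨x, hx, hm⟩ := isCompact_Icc.exists_isMinOn (nonempty_Icc.2 hR0) hc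
    exact ⟨_, hp x hx.1, fun y hy => hm hy⟩
  obtain ⟨m1, hm1, w1⟩ := low Φ φ (fun x hx => (hcont x hx).1) q1 nc1
  obtain ⟨m2, hm2, w2⟩ := low Ψ ψ (fun x hx => (hcont x hx).2) q2 nc2
  let C := k * (P.C1 + P.swap.C1) + 1
  have n1 := g.C1_nn
  have n2 := g.swap.C1_nn
  have hk0 : 0 < k := by linarith
  have hC : 0 < C := by
    have := mul_nonneg hk0.le (add_nonneg n1 n2)
    simp only [C]; linarith
  let p := max t (t0 - min m1 m2 / C)
  have hpt : t ≤ p := le_max_left _ _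
  have hpm : t0 - p ≤ min m1 m2 / C := by
    have := le_max_right t (t0 - min m1 m2 / C)
    simp only [p]; linarith
  have hp0 : p < t0 := by
    refine max_lt htlt ?_
    have : 0 < min m1 m2 / C := div_pos (lt_min hm1 hm2) hC
    linarith
  have hpC : C * (t0 - p) ≤ min m1 m2 := by
    rw [le_div_iff₀ hC] at hpm; linarith
  have hd0 : 0 ≤ t0 - p := by linarith
  have ek1 : k * (P.C1 * (t0 - p)) ≤ m1 := by
    refine le_trans ?_ (hpC.trans (min_le_left _ _))
    have := mul_nonneg hk0.le (mul_nonneg n2 hd0)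
    simp only [C]; nlinarith
  have ek2 : k * (P.swap.C1 * (t0 - p)) ≤ m2 := by
    refine le_trans ?_ (hpC.trans (min_le_right _ _))
    have := mul_nonneg hk0.le (mul_nonneg n1 hd0)
    simp only [C]; nlinarith
  have hpG : p ∈ Gd := by
    refine ⟨ht.trans_le hpt, fun x hx => ?_⟩
    by_cases hxR : x ≤ R - t
    · have ix0 : x + t0 ∈ Ioi A := by simp only [mem_Ioi]; linarith
      have ixp : x + p ∈ Ioi A := by simp only [mem_Ioi]; linarith
      have f1 := (abs_le.1 (H.φ_lip g hs' ix0 ixp)).2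
      have f2 := (abs_le.1 (H.swap.φ_lip g.swap hs' ix0 ixp)).2
      have ea : |x + t0 - (x + p)| = t0 - p := by
        rw [abs_of_nonneg (by linarith)]; ring
      rw [ea] at f1 f2
      have g1 := mul_le_mul_of_nonneg_left f1 hk0.le
      have g2 := mul_le_mul_of_nonneg_left f2 hk0.le
      have v1 := w1 x ⟨hx.le, hxR⟩
      have v2 := w2 x ⟨hx.le, hxR⟩
      constructor <;> linarith
    · push Not at hxR
      exact ⟨(h.rφ x hx).2.trans (hR _ (by linarith)).1,
        (h.rψ x hx).2.trans (hR _ (by linarith)).2⟩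
  have := csInf_le hbd hpG
  linarith

def Eop (l : ℝ) (g : ℝ → ℝ) (x : ℝ) : ℝ :=
  ∫ t in Ioi (0:ℝ), Real.exp (-l * t) * g (x + t)

structure MB (g : ℝ → ℝ) (m M : ℝ) : Prop where
  mono : Monotone g
  lo : ∀ x, m ≤ g x
  hi : ∀ x, g x ≤ M

lemma MB.shift {g : ℝ → ℝ} {m M : ℝ} (h : MB g m M) (x : ℝ) : MB (fun t => g (x + t)) m M :=
  ⟨fun y z hyz => h.mono (by linarith), fun _ => h.lo _, fun _ => h.hi _⟩

lemma MB.int {g : ℝ → ℝ} {m M l : ℝ} (h : MB g m M) (hl : 0 < l) (x : ℝ) :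
    MeasureTheory.IntegrableOn (fun t => Real.exp (-l * t) * g t) (Ioi x) := by
  refine MeasureTheory.Integrable.mul_bdd (c := max |m| |M|) (exp_neg_integrableOn_Ioi x hl)
    h.mono.measurable.aestronglyMeasurable ?_
  exact Eventually.of_forall fun t => by
    rw [Real.norm_eq_abs]
    exact abs_le_max_abs_abs (h.lo t) (h.hi t)

lemma Eop_mono {g g' : ℝ → ℝ} {m M m' M' l : ℝ} (h : MB g m M) (h' : MB g' m' M') (hl : 0 < l)
    {x x' : ℝ} (hg : ∀ t, g (x + t) ≤ g' (x' + t)) : Eop l g x ≤ Eop l g' x' := by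
  refine MeasureTheory.setIntegral_mono ((h.shift x).int hl 0) ((h'.shift x').int hl 0) ?_
  intro t
  exact mul_le_mul_of_nonneg_left (hg t) (Real.exp_pos _).le

lemma Eop_const {l : ℝ} (hl : 0 < l) (m x : ℝ) : Eop l (fun _ => m) x = m / l := by
  unfold Eop
  rw [MeasureTheory.integral_mul_const, integral_exp_mul_Ioi (by linarith)]
  simp
  field_simp

lemma Eop_MB {g : ℝ → ℝ} {m M l : ℝ} (h : MB g m M) (hl : 0 < l) :
    MB (Eop l g) (m / l) (M / l) := by
  refine ⟨fun x y hxy => Eop_mono h h hl fun t => h.mono (by linarith), fun x => ?_, fun x => ?_⟩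
  · rw [← Eop_const hl m x]
    exact Eop_mono (m := m) (M := m) ⟨fun _ _ _ => le_rfl, fun _ => le_rfl, fun _ => le_rfl⟩ h hl
      fun t => h.lo _
  · rw [← Eop_const hl M x]
    exact Eop_mono h (m' := M) (M' := M) ⟨fun _ _ _ => le_rfl, fun _ => le_rfl, fun _ => le_rfl⟩ hl
      fun t => h.hi _

lemma Eop_eq {g : ℝ → ℝ} {m M l : ℝ} (h : MB g m M) (hl : 0 < l) (x : ℝ) :
    Eop l g x = Real.exp (l * x) * ((∫ t in Ioi (0:ℝ), Real.exp (-l * t) * g t) -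
      ∫ t in (0:ℝ)..x, Real.exp (-l * t) * g t) := by
  have h1 := intervalIntegral.integral_interval_add_Ioi (h.int hl 0) (h.int hl x)
  have h2 := (MeasureTheory.measurePreserving_add_right MeasureTheory.volume x).setIntegral_preimage_emb
    (MeasurableEquiv.addRight x).measurableEmbedding (fun t => Real.exp (-l * t) * g t) (Ioi x)
  rw [preimage_add_const_Ioi, sub_self] at h2
  rw [← h1, add_sub_cancel_left, ← h2, ← MeasureTheory.integral_const_mul]
  unfold Eop
  congr 1
  ext t
  rw [← mul_assoc, ← Real.exp_add, add_comm x t]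
  congr 2
  ring

lemma MB.ii {g : ℝ → ℝ} {m M l : ℝ} (h : MB g m M) (hl : 0 < l) (x y : ℝ) :
    IntervalIntegrable (fun t => Real.exp (-l * t) * g t) MeasureTheory.volume x y := by
  constructor
  · exact (h.int hl x).mono_set Ioc_subset_Ioi_self
  · exact (h.int hl y).mono_set Ioc_subset_Ioi_self

lemma Eop_cont {g : ℝ → ℝ} {m M l : ℝ} (h : MB g m M) (hl : 0 < l) : Continuous (Eop l g) := by
  have : Eop l g = fun x => _ := funext (Eop_eq h hl)
  rw [this]
  have := intervalIntegral.continuous_primitive (fun x y => h.ii hl x y) 0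
  fun_prop

lemma Eop_deriv {g : ℝ → ℝ} {m M l : ℝ} (h : MB g m M) (hl : 0 < l) {x : ℝ}
    (hc : ContinuousAt g x) : HasDerivAt (Eop l g) (l * Eop l g x - g x) x := by
  have e : Eop l g = fun x => _ := funext (Eop_eq h hl)
  have h1 := intervalIntegral.integral_hasDerivAt_right (h.ii hl 0 x)
    (by
      refine Measurable.stronglyMeasurable ?_ |>.stronglyMeasurableAtFilter
      have := h.mono.measurable
      fun_prop) (by fun_prop)
  have h2 : HasDerivAt (fun x => Real.exp (l * x)) (Real.exp (l * x) * (l * 1)) x :=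
    ((hasDerivAt_id x).const_mul l).exp
  have h3 := h2.mul (h1.const_sub (∫ t in Ioi (0:ℝ), Real.exp (-l * t) * g t))
  rw [Eop_eq h hl x, e]
  refine HasDerivAt.congr_deriv h3 ?_
  have : Real.exp (l * x) * Real.exp (-l * x) = 1 := by
    rw [← Real.exp_add]; simp
  linear_combination (-g x) * this

structure Kap (d s K l k : ℝ) : Prop where
  hd : 0 < d
  hK : 0 < K
  hl : 0 < l
  hk : 0 < k
  m : d * (l * k) = K
  hs : d * (l - k) = s

lemma exists_kap {d s K : ℝ} (hd : 0 < d) (hK : 0 < K) : ∃ l k, Kap d s K l k := by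
  have h0 : 0 < s ^ 2 + 4 * d * K := by positivity
  have h1 := Real.sq_sqrt h0.le
  have h2 : |s| < √(s ^ 2 + 4 * d * K) := by
    rw [← Real.sqrt_sq_eq_abs]
    exact Real.sqrt_lt_sqrt (by positivity) (by have := mul_pos hd hK; linarith)
  obtain ⟨h3, h4⟩ := abs_lt.1 h2
  set r := √(s ^ 2 + 4 * d * K)
  refine ⟨(s + r) / (2 * d), (r - s) / (2 * d), hd, hK, div_pos (by linarith) (by linarith),
    div_pos (by linarith) (by linarith), ?_, ?_⟩
  · field_simp; linear_combination h1
  · field_simp; ring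

def gt (l k d p : ℝ) (H : ℝ → ℝ) (x : ℝ) : ℝ := if 0 < x then Eop l H x / d - k * p else 0

def Sop (l k d p : ℝ) (H : ℝ → ℝ) (x : ℝ) : ℝ :=
  p - Eop k (fun y => - gt l k d p H (-y)) (-x)

lemma gt_MB {d s K l k p q : ℝ} (h : Kap d s K l k) {H : ℝ → ℝ} (hH : MB H (K * p) (K * q))
    (hpq : p ≤ q) :
    MB (fun y => - gt l k d p H (-y)) (-(k * (q - p))) 0 := by
  have h1 := Eop_MB hH h.hl
  have e : ∀ z, K * z / l / d = k * z := by
    intro z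
    have := h.hl.ne'
    have := h.hd.ne'
    rw [← h.m]; field_simp
  have h2 : ∀ x, k * p ≤ Eop l H x / d := by
    intro x; rw [← e p]; exact (div_le_div_iff_of_pos_right h.hd).2 (h1.lo x)
  have h3 : ∀ x, Eop l H x / d ≤ k * q := by
    intro x; rw [← e q]; exact (div_le_div_iff_of_pos_right h.hd).2 (h1.hi x)
  have hk := h.hk
  have hkpq : 0 ≤ k * (q - p) := mul_nonneg hk.le (by linarith)
  refine ⟨fun x y hxy => ?_, fun x => ?_, fun x => ?_⟩
  · simp only [gt]
    split_ifs with c1 c2 c2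
    · have : Eop l H (-y) / d ≤ Eop l H (-x) / d :=
        (div_le_div_iff_of_pos_right h.hd).2 (h1.mono (by linarith))
      linarith
    · linarith [h2 (-x)]
    · linarith
    · linarith
  · simp only [gt]
    split_ifs
    · linarith [h3 (-x)]
    · linarith
  · simp only [gt]
    split_ifs
    · linarith [h2 (-x)]
    · linarith

lemma Sop_MB {d s K l k p q : ℝ} (h : Kap d s K l k) {H : ℝ → ℝ} (hH : MB H (K * p) (K * q))
    (hpq : p ≤ q) : MB (Sop l k d p H) p q := by
  have h1 := Eop_MB (gt_MB h hH hpq) h.hk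
  have hk := h.hk.ne'
  refine ⟨fun x y hxy => ?_, fun x => ?_, fun x => ?_⟩
  · have := h1.mono (neg_le_neg hxy)
    simp only [Sop]; linarith
  · have := h1.hi (-x)
    simp only [Sop]; rw [zero_div] at this; linarith
  · have := h1.lo (-x)
    have e : -(k * (q - p)) / k = p - q := by field_simp; ring
    simp only [Sop]; rw [e] at this; linarith

lemma Sop_mono {d s K l k p q : ℝ} (h : Kap d s K l k) {H H' : ℝ → ℝ}
    (hH : MB H (K * p) (K * q)) (hH' : MB H' (K * p) (K * q)) (hpq : p ≤ q)
    (le : ∀ x, H x ≤ H' x) (x : ℝ) : Sop l k d p H x ≤ Sop l k d p H' x := by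
  have := Eop_mono (gt_MB h hH' hpq) (gt_MB h hH hpq) h.hk (x := -x) (x' := -x) (fun t => by
    simp only [gt]
    split_ifs
    · have : Eop l H (-(-x + t)) / d ≤ Eop l H' (-(-x + t)) / d :=
        (div_le_div_iff_of_pos_right h.hd).2 (Eop_mono hH hH' h.hl fun t => le _)
      linarith
    · linarith)
  simp only [Sop]; linarith

lemma Sop_cont {d s K l k p q : ℝ} (h : Kap d s K l k) {H : ℝ → ℝ} (hH : MB H (K * p) (K * q))
    (hpq : p ≤ q) : Continuous (Sop l k d p H) := by
  have := Eop_cont (gt_MB h hH hpq) h.hk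
  unfold Sop; fun_prop

lemma Sop_zero {d l k p : ℝ} {H : ℝ → ℝ} : Sop l k d p H 0 = p := by
  unfold Sop Eop
  rw [MeasureTheory.setIntegral_congr_fun measurableSet_Ioi (g := fun _ => (0:ℝ))]
  · simp
  · intro t ht
    have : ¬ (0 < -(-0 + t)) := by simp only [mem_Ioi] at ht; simp; linarith
    simp only [gt, if_neg this]
    simp

lemma Sop_deriv {d s K l k p q : ℝ} (h : Kap d s K l k) {H : ℝ → ℝ} (hH : MB H (K * p) (K * q))
    (hpq : p ≤ q) {x : ℝ} (hx : 0 < x) :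
    HasDerivAt (Sop l k d p H) (Eop l H x / d - k * Sop l k d p H x) x := by
  have hc := Eop_cont hH h.hl
  have h0 : ContinuousAt (fun y => - gt l k d p H (-y)) (-x) := by
    have : ContinuousAt (fun y => - (Eop l H (-y) / d - k * p)) (-x) := by fun_prop
    refine this.congr ?_
    filter_upwards [gt_mem_nhds (show -x < 0 by linarith)] with y hy
    rw [gt, if_pos (by linarith)]
  have h1 := Eop_deriv (gt_MB h hH hpq) h.hk h0
  have h2 := (HasDerivAt.scomp x h1 (hasDerivAt_neg x)).const_sub p
  refine HasDerivAt.congr_deriv h2 ?_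
  simp only [Sop, gt, neg_neg, if_pos hx, smul_eq_mul]
  ring

lemma Sop_deriv2 {d s K l k p q : ℝ} (h : Kap d s K l k) {H : ℝ → ℝ} (hH : MB H (K * p) (K * q))
    (hpq : p ≤ q) {x : ℝ} (hx : 0 < x) (hc : ContinuousAt H x) :
    HasDerivAt (fun x => Eop l H x / d - k * Sop l k d p H x)
      ((s * (Eop l H x / d - k * Sop l k d p H x) + K * Sop l k d p H x - H x) / d) x := by
  have h1 := ((Eop_deriv hH h.hl hc).div_const d).sub ((Sop_deriv h hH hpq hx).const_mul k)
  refine HasDerivAt.congr_deriv h1 ?_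
  have := h.hd.ne'
  rw [← h.m, ← h.hs]; field_simp; ring

def Hop (P : Par) (K : ℝ) (φ ψ : ℝ → ℝ) (x : ℝ) : ℝ := (K - P.a) * φ x + P.b * ψ x - P.F (φ x)

lemma Hop_aux {P : Par} (g : Good P) {K z z' : ℝ} (hK : P.a + P.L ≤ K) (h0 : 0 ≤ z) (h1 : z ≤ z')
    (h2 : z' ≤ P.u) : (K - P.a) * z - P.F z ≤ (K - P.a) * z' - P.F z' := by
  have := g.lF z' ⟨h0.trans h1, h2⟩ z ⟨h0, h1.trans h2⟩
  have h3 := (abs_le.1 this).2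
  rw [abs_of_nonneg (by linarith)] at h3
  nlinarith

lemma Hop_mono {P : Par} (g : Good P) {K : ℝ} (hK : P.a + P.L ≤ K) {φ ψ φ' ψ' : ℝ → ℝ} {x y : ℝ}
    (h0 : 0 ≤ φ x) (h1 : φ x ≤ φ' y) (h2 : φ' y ≤ P.u) (h3 : ψ x ≤ ψ' y) :
    Hop P K φ ψ x ≤ Hop P K φ' ψ' y := by
  have := Hop_aux g hK h0 h1 h2
  have := mul_le_mul_of_nonneg_left h3 g.b.le
  unfold Hop; linarith

lemma Hop_MB {P : Par} (g : Good P) {K p q : ℝ} (hK : P.a + P.L ≤ K) {φ ψ : ℝ → ℝ}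
    (hp : 0 ≤ p) (hpu : p ≤ P.u) (h1 : P.a * p + P.F p ≤ P.b * q)
    (hφ : MB φ p P.u) (hψ : MB ψ q P.v) : MB (Hop P K φ ψ) (K * p) (K * P.u) := by
  refine ⟨fun x y hxy => Hop_mono g hK (hp.trans (hφ.lo x)) (hφ.mono hxy) (hφ.hi y) (hψ.mono hxy),
    fun x => ?_, fun x => ?_⟩
  · have := Hop_aux g hK hp (hφ.lo x) (hφ.hi x)
    have := mul_le_mul_of_nonneg_left (hψ.lo x) g.b.le
    unfold Hop; linarith
  · have := Hop_aux g hK (hp.trans (hφ.lo x)) (hφ.hi x) le_rfl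
    have := mul_le_mul_of_nonneg_left (hψ.hi x) g.b.le
    have := g.e1
    unfold Hop; linarith

def mkO {p q : ℝ} (f : ℝ → ℝ) (h : MB f p q) : ℝ →o Icc p q :=
  ⟨fun x => ⟨f x, h.lo x, h.hi x⟩, fun _ _ hxy => h.mono hxy⟩

def unO {p q : ℝ} (f : ℝ →o Icc p q) (x : ℝ) : ℝ := (f x : ℝ)

lemma unO_MB {p q : ℝ} (f : ℝ →o Icc p q) : MB (unO f) p q :=
  ⟨fun _ _ hxy => f.monotone hxy, fun x => (f x).2.1, fun x => (f x).2.2⟩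

lemma fixed_half {P : Par} (g : Good P) {s K l k p q : ℝ} (hK : P.a + P.L ≤ K)
    (hk : Kap P.d1 s K l k)
    (hp : 0 ≤ p) (hpu : p ≤ P.u) (h1 : P.a * p + P.F p ≤ P.b * q) {φ ψ : ℝ → ℝ}
    (hφ : MB φ p P.u) (hψ : MB ψ q P.v) (e : φ = Sop l k P.d1 p (Hop P K φ ψ)) :
    φ 0 = p ∧ Continuous φ ∧ (Continuous ψ → ∃ φ1 : ℝ → ℝ, (∀ x ∈ Ioi (0:ℝ), HasDerivAt φ (φ1 x) x) ∧
      ∀ x ∈ Ioi (0:ℝ),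
        HasDerivAt φ1 ((s * φ1 x + P.a * φ x - P.b * ψ x + P.F (φ x)) / P.d1) x) := by
  have hH := Hop_MB g hK hp hpu h1 hφ hψ
  have hc : Continuous φ := by
    rw [e]; exact Sop_cont hk hH hpu
  refine ⟨by rw [e]; exact Sop_zero, hc, fun hcψ =>
    ⟨fun x => Eop l (Hop P K φ ψ) x / P.d1 - k * φ x, fun x hx => ?_, fun x hx => ?_⟩⟩
  · have := Sop_deriv hk hH hpu hx
    rw [← e] at this; exact this
  · have hcH : ContinuousAt (Hop P K φ ψ) x := by
      have : ContinuousAt (fun x => P.F (φ x)) x :=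
        tendsto_F g (Eventually.of_forall fun x => ⟨hp.trans (hφ.lo x), hφ.hi x⟩)
          ⟨hp.trans (hφ.lo x), hφ.hi x⟩ hc.continuousAt
      unfold Hop; fun_prop
    have := Sop_deriv2 hk hH hpu hx hcH
    rw [← e] at this
    refine this.congr_deriv ?_
    unfold Hop
    congr 1; ring

lemma tarski {α : Type*} [CompleteLattice α] (f : α → α) (h : Monotone f) : ∃ z, f z = z :=
  ⟨_, OrderHom.map_lfp ⟨f, h⟩⟩

lemma fixed {P : Par} (g : Good P) {s p q : ℝ} (hp : 0 ≤ p) (hpu : p ≤ P.u) (hq : 0 ≤ q)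
    (hqv : q ≤ P.v) (h1 : P.a * p + P.F p ≤ P.b * q) (h2 : P.d * q + P.G q ≤ P.c * p) :
    ∃ φ ψ φ1 ψ1 : ℝ → ℝ, MS P s (Ioi 0) φ ψ φ1 ψ1 ∧ φ 0 = p ∧ ψ 0 = q ∧ Continuous φ ∧
      Continuous ψ ∧ ∀ x, p ≤ φ x := by
  set K := max (P.a + P.L) (P.d + P.L) with hKdef
  have hK1 : P.a + P.L ≤ K := le_max_left _ _
  have hK2 : P.d + P.L ≤ K := le_max_right _ _
  have hK : 0 < K := by have := g.a; have := g.L; linarith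
  obtain ⟨l, k, hk⟩ := exists_kap (s := s) g.d1 hK
  obtain ⟨l', k', hk'⟩ := exists_kap (s := s) g.d2 hK
  have : Fact (p ≤ P.u) := ⟨hpu⟩
  have : Fact (q ≤ P.v) := ⟨hqv⟩
  have m1 : ∀ z : (ℝ →o Icc p P.u) × (ℝ →o Icc q P.v),
      MB (Hop P K (unO z.1) (unO z.2)) (K * p) (K * P.u) := fun z =>
    Hop_MB g hK1 hp hpu h1 (unO_MB z.1) (unO_MB z.2)
  have m2 : ∀ z : (ℝ →o Icc p P.u) × (ℝ →o Icc q P.v),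
      MB (Hop P.swap K (unO z.2) (unO z.1)) (K * q) (K * P.v) := fun z =>
    Hop_MB g.swap hK2 hq hqv h2 (unO_MB z.2) (unO_MB z.1)
  let T : ((ℝ →o Icc p P.u) × (ℝ →o Icc q P.v)) → ((ℝ →o Icc p P.u) × (ℝ →o Icc q P.v)) :=
    fun z => ⟨mkO _ (Sop_MB hk (m1 z) hpu), mkO _ (Sop_MB hk' (m2 z) hqv)⟩
  have hTm : Monotone T := by
      intro z z' hz
      refine ⟨fun x => ?_, fun x => ?_⟩
      · exact Sop_mono hk (m1 z) (m1 z') hpu (fun x => Hop_mono g hK1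
          (hp.trans ((unO_MB z.1).lo x)) (hz.1 x) ((unO_MB z'.1).hi x) (hz.2 x)) x
      · exact Sop_mono hk' (m2 z) (m2 z') hqv (fun x => Hop_mono g.swap hK2
          (hq.trans ((unO_MB z.2).lo x)) (hz.2 x) ((unO_MB z'.2).hi x) (hz.1 x)) x
  obtain ⟨z, hT⟩ := tarski T hTm
  have e1 : unO z.1 = Sop l k P.d1 p (Hop P K (unO z.1) (unO z.2)) := by
    have : (T z).1 = z.1 := by rw [hT]
    ext x
    have := DFunLike.congr_fun this x
    have := congrArg Subtype.val this
    exact this.symm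
  have e2 : unO z.2 = Sop l' k' P.d2 q (Hop P.swap K (unO z.2) (unO z.1)) := by
    have : (T z).2 = z.2 := by rw [hT]
    ext x
    have := DFunLike.congr_fun this x
    have := congrArg Subtype.val this
    exact this.symm
  obtain ⟨a1, a2, a3⟩ := fixed_half g hK1 hk hp hpu h1 (unO_MB z.1) (unO_MB z.2) e1
  obtain ⟨b1, b2, b3⟩ := fixed_half g.swap hK2 hk' hq hqv h2 (unO_MB z.2) (unO_MB z.1) e2
  obtain ⟨φ1, c1, c2⟩ := a3 b2
  obtain ⟨ψ1, c3, c4⟩ := b3 a2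
  exact ⟨unO z.1, unO z.2, φ1, ψ1, ⟨isOpen_Ioi, isUpperSet_Ioi 0, c1, c3, c2, c4,
    (unO_MB z.1).mono.monotoneOn _, (unO_MB z.2).mono.monotoneOn _,
    fun x _ => ⟨hp.trans ((unO_MB z.1).lo x), (unO_MB z.1).hi x⟩,
    fun x _ => ⟨hq.trans ((unO_MB z.2).lo x), (unO_MB z.2).hi x⟩⟩, a1, b1, a2, b2, (unO_MB z.1).lo⟩

lemma small_pq {P : Par} (g : Good P) {ε : ℝ} (hε : 0 < ε) :
    ∃ p q, 0 < p ∧ p < ε ∧ p ≤ P.u ∧ 0 < q ∧ q < ε ∧ q ≤ P.v ∧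
      P.a * p + P.F p ≤ P.b * q ∧ P.d * q + P.G q ≤ P.c * p := by
  have ha := g.a
  have hb := g.b
  have hc := g.c
  have hd := g.d
  have hr : P.a / P.b < P.c / P.d := by
    rw [div_lt_div_iff₀ hb hd]; linarith [g.bcad]
  obtain ⟨r, r1, r2⟩ := exists_between hr
  have r0 : 0 < r := lt_trans (by positivity) r1
  rw [div_lt_iff₀ hb] at r1
  rw [lt_div_iff₀ hd] at r2
  obtain ⟨δ1, δ1p, h1⟩ := g.sF (r * P.b - P.a) (by linarith)
  obtain ⟨δ2, δ2p, h2⟩ := g.sG ((P.c - r * P.d) / r) (div_pos (by linarith) r0)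
  obtain ⟨p, p0, hp⟩ : ∃ p, 0 < p ∧ p < min (min (min ε P.u) δ1) (min (min ε P.v) δ2 / r) := by
    apply exists_between
    have := g.u
    have := g.v
    have : 0 < min (min ε P.v) δ2 / r := by positivity
    simp [*]
  simp only [lt_min_iff, lt_div_iff₀ r0] at hp
  obtain ⟨⟨⟨p1, p2⟩, p3⟩, ⟨q1, q2⟩, q3⟩ := hp
  refine ⟨p, p * r, p0, p1, p2.le, by positivity, q1, q2.le, ?_, ?_⟩
  · have := h1 p p0.le p3.le
    nlinarith
  · have := h2 (p * r) (by positivity) q3.le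
    have e : (P.c - r * P.d) / r * (p * r) = (P.c - r * P.d) * p := by field_simp
    rw [e] at this
    nlinarith

structure Z0 (P : Par) (s : ℝ) (φ ψ φ1 ψ1 : ℝ → ℝ) : Prop where
  ms : MS P s (Ioi 0) φ ψ φ1 ψ1
  z1 : φ 0 = 0
  z2 : ψ 0 = 0
  b1 : ∀ x > 0, φ x ≤ P.C1 * x
  b2 : ∀ x > 0, ψ x ≤ P.swap.C1 * x

lemma Z0.swap {P : Par} {s : ℝ} {φ ψ φ1 ψ1 : ℝ → ℝ} (h : Z0 P s φ ψ φ1 ψ1) :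
    Z0 P.swap s ψ φ ψ1 φ1 := ⟨h.ms.swap, h.z2, h.z1, h.b2, h.b1⟩

lemma Z0.tend {P : Par} {s : ℝ} {φ ψ φ1 ψ1 : ℝ → ℝ} (h : Z0 P s φ ψ φ1 ψ1) :
    Tendsto φ (𝓝[>] 0) (𝓝 0) := by
  have : Tendsto (fun x => P.C1 * x) (𝓝[>] 0) (𝓝 0) := by
    have : Tendsto (fun x => P.C1 * x) (𝓝 0) (𝓝 (P.C1 * 0)) := (continuous_const_mul _).tendsto _
    rw [mul_zero] at this
    exact this.mono_left nhdsWithin_le_nhds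
  refine squeeze_zero' ?_ ?_ this
  · filter_upwards [self_mem_nhdsWithin] with x hx using (h.ms.rφ x hx).1
  · filter_upwards [self_mem_nhdsWithin] with x hx using h.b1 x hx

lemma contOn_Ici {φ φ1 : ℝ → ℝ} (h : ∀ x ∈ Ioi (0:ℝ), HasDerivAt φ (φ1 x) x)
    (t : Tendsto φ (𝓝[>] 0) (𝓝 (φ 0))) : ContinuousOn φ (Ici 0) := by
  intro x hx
  rcases eq_or_lt_of_le (mem_Ici.1 hx) with h0 | h0
  · subst h0
    exact continuousWithinAt_Ioi_iff_Ici.1 t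
  · exact (h x h0).continuousAt.continuousWithinAt

lemma Z0.cont {P : Par} {s : ℝ} {φ ψ φ1 ψ1 : ℝ → ℝ} (h : Z0 P s φ ψ φ1 ψ1) :
    ContinuousOn φ (Ici 0) :=
  contOn_Ici h.ms.hφ (by rw [h.z1]; exact h.tend)

lemma Z0.props {P : Par} (g : Good P) {s : ℝ} (hs : 0 ≤ s) {φ ψ φ1 ψ1 : ℝ → ℝ}
    (h : Z0 P s φ ψ φ1 ψ1) {x : ℝ} (hx : 0 < x) (hp : 0 < φ x) :
    (StrictMonoOn φ (Ioi 0) ∧ StrictMonoOn ψ (Ioi 0)) ∧ (∀ x > 0, 0 < φ x ∧ 0 < ψ x) ∧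
    Tendsto φ atTop (𝓝 P.u) ∧ Tendsto ψ atTop (𝓝 P.v) := by
  obtain ⟨y, hy1, hy⟩ := (((h.tend).eventually (gt_mem_nhds g.u)).and self_mem_nhdsWithin).exists
  exact ⟨h.ms.strict g hs hx hy hp hy1, h.ms.posD g hs hx hy hp hy1, h.ms.lim_top g hs hx hp⟩

lemma bd_of_tend {P : Par} (g : Good P) {s p : ℝ} (hs : 0 ≤ s) {φ ψ φ1 ψ1 : ℝ → ℝ}
    (h : MS P s (Ioi 0) φ ψ φ1 ψ1) (t : Tendsto φ (𝓝[>] 0) (𝓝 p)) :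
    ∀ x > 0, φ x ≤ p + P.C1 * x := by
  intro x hx
  have t2 : Tendsto (fun y => φ y + P.C1 * x) (𝓝[>] 0) (𝓝 (p + P.C1 * x)) := t.add_const _
  refine ge_of_tendsto t2 ?_
  filter_upwards [Ioo_mem_nhdsGT hx] with y hy
  have h1 := (abs_le.1 (h.φ_lip g hs hx hy.1)).2
  rw [abs_of_pos (by linarith [hy.2])] at h1
  have := mul_nonneg g.C1_nn hy.1.le
  linarith

lemma MS.congr {P : Par} {s : ℝ} {D : Set ℝ} {φ ψ φ1 ψ1 φ' ψ' : ℝ → ℝ} (h : MS P s D φ ψ φ1 ψ1)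
    (e1 : EqOn φ' φ D) (e2 : EqOn ψ' ψ D) : MS P s D φ' ψ' φ1 ψ1 := by
  refine ⟨h.op, h.up, fun x hx => (h.hφ x hx).congr_of_eventuallyEq (e1.eventuallyEq_of_mem (h.op.mem_nhds hx)),
    fun x hx => (h.hψ x hx).congr_of_eventuallyEq (e2.eventuallyEq_of_mem (h.op.mem_nhds hx)),
    fun x hx => ?_, fun x hx => ?_, h.mφ.congr e1.symm, h.mψ.congr e2.symm, fun x hx => ?_,
    fun x hx => ?_⟩
  · rw [e1 hx, e2 hx]; exact h.hφ1 x hx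
  · rw [e1 hx, e2 hx]; exact h.hψ1 x hx
  · rw [e1 hx]; exact h.rφ x hx
  · rw [e2 hx]; exact h.rψ x hx

lemma compactZ {P : Par} (g : Good P) {ι : Type*} (U : Ultrafilter ι) {s : ι → ℝ}
    {φ ψ φ1 ψ1 : ι → ℝ → ℝ} {s0 : ℝ} {p q : ι → ℝ}
    (h : ∀ᶠ i in (U : Filter ι), 0 ≤ s i ∧ MS P (s i) (Ioi 0) (φ i) (ψ i) (φ1 i) (ψ1 i))
    (hp : ∀ᶠ i in (U : Filter ι), ∀ x > 0, φ i x ≤ p i + P.C1 * x)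
    (hq : ∀ᶠ i in (U : Filter ι), ∀ x > 0, ψ i x ≤ q i + P.swap.C1 * x)
    (tp : Tendsto p U (𝓝 0)) (tq : Tendsto q U (𝓝 0))
    (hs : Tendsto s U (𝓝 s0)) :
    ∃ Φ Ψ Φ1 Ψ1 : ℝ → ℝ, Z0 P s0 Φ Ψ Φ1 Ψ1 ∧
      (∀ x > 0, Tendsto (fun i => φ i x) U (𝓝 (Φ x))) ∧
      (∀ x > 0, Tendsto (fun i => ψ i x) U (𝓝 (Ψ x))) ∧
      (∀ x > 0, Tendsto (fun i => φ1 i x) U (𝓝 (Φ1 x))) ∧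
      (∀ x > 0, Tendsto (fun i => ψ1 i x) U (𝓝 (Ψ1 x))) := by
  obtain ⟨Φ, Ψ, Φ1, Ψ1, hM, t1, t2, t3, t4⟩ := compact g U h hs isOpen_Ioi (isUpperSet_Ioi (0:ℝ))
    (fun x hx => Eventually.of_forall fun _ => hx)
  have e1 : EqOn (fun x => if 0 < x then Φ x else 0) Φ (Ioi 0) := fun x hx => if_pos hx
  have e2 : EqOn (fun x => if 0 < x then Ψ x else 0) Ψ (Ioi 0) := fun x hx => if_pos hx
  refine ⟨_, _, Φ1, Ψ1, ⟨hM.congr e1 e2, by simp, by simp, fun x hx => ?_, fun x hx => ?_⟩,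
    fun x hx => ?_, fun x hx => ?_, t3, t4⟩
  · rw [if_pos hx]
    have := tp.add_const (P.C1 * x)
    rw [zero_add] at this
    exact le_of_tendsto_of_tendsto (t1 x hx) this (hp.mono fun i hi => hi x hx)
  · rw [if_pos hx]
    have := tq.add_const (P.swap.C1 * x)
    rw [zero_add] at this
    exact le_of_tendsto_of_tendsto (t2 x hx) this (hq.mono fun i hi => hi x hx)
  · rw [if_pos hx]; exact t1 x hx
  · rw [if_pos hx]; exact t2 x hx

def SS (P : Par) (s : ℝ) : Prop :=
  ∃ φ ψ φ1 ψ1 : ℝ → ℝ, Z0 P s φ ψ φ1 ψ1 ∧ ∃ x > 0, 0 < φ x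

def TT (P : Par) (s : ℝ) : Prop :=
  ∃ φ ψ φ1 ψ1 : ℝ → ℝ, MS P s univ φ ψ φ1 ψ1 ∧ φ 0 = P.u / 2

lemma dich {P : Par} (g : Good P) {s : ℝ} (hs : 0 ≤ s) : SS P s ∨ TT P s := by
  have hu := g.u
  have hex : ∀ n : ℕ, ∃ (p q : ℝ) (φ ψ φ1 ψ1 : ℝ → ℝ) (ξ : ℝ), 0 < p ∧ 0 < q ∧
      p < 1 / ((n:ℝ) + 1) ∧ q < 1 / ((n:ℝ) + 1) ∧ MS P s (Ioi 0) φ ψ φ1 ψ1 ∧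
      (∀ x > 0, φ x ≤ p + P.C1 * x) ∧ (∀ x > 0, ψ x ≤ q + P.swap.C1 * x) ∧
      0 < ξ ∧ φ ξ = P.u / 2 := by
    intro n
    have hε : 0 < min (1 / ((n:ℝ) + 1)) (P.u / 2) := lt_min (by positivity) (by positivity)
    obtain ⟨p, q, p0, p1, p2, q0, q1, q2, r1, r2⟩ := small_pq g hε
    obtain ⟨φ, ψ, φ1, ψ1, h, e1, e2, c1, c2, lo⟩ := fixed g (s := s) p0.le p2 q0.le q2 r1 r2
    obtain ⟨l1, -⟩ := h.lim_top g hs (x0 := 1) (mem_Ioi.2 one_pos) (p0.trans_le (lo 1))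
    obtain ⟨X, hX, hX0⟩ := ((l1.eventually (lt_mem_nhds (by linarith : P.u / 2 < P.u))).and
      (eventually_gt_atTop 0)).exists
    rw [lt_min_iff] at p1 q1
    obtain ⟨ξ, hξ, e⟩ := intermediate_value_Icc hX0.le c1.continuousOn
      (show P.u / 2 ∈ Icc (φ 0) (φ X) from ⟨by rw [e1]; exact p1.2.le, hX.le⟩)
    have hξ0 : 0 < ξ := by
      refine lt_of_le_of_ne hξ.1 fun h0 => ?_
      rw [← h0, e1] at e
      exact p1.2.ne e
    refine ⟨p, q, φ, ψ, φ1, ψ1, ξ, p0, q0, p1.1, q1.1, h, ?_, ?_, hξ0, e⟩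
    · refine bd_of_tend g hs h ?_
      rw [← e1]; exact c1.continuousAt.mono_left nhdsWithin_le_nhds
    · refine bd_of_tend g.swap hs h.swap ?_
      rw [← e2]; exact c2.continuousAt.mono_left nhdsWithin_le_nhds
  choose p q φ ψ φ1 ψ1 ξ p0 q0 p1 q1 h b1 b2 hξ e using hex
  let U : Ultrafilter ℕ := Ultrafilter.of atTop
  have hU : (U : Filter ℕ) ≤ atTop := Ultrafilter.of_le atTop
  have tp : Tendsto p U (𝓝 0) := squeeze_zero (fun n => (p0 n).le) (fun n => (p1 n).le)
    (tendsto_one_div_add_atTop_nhds_zero_nat.mono_left hU)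
  have tq : Tendsto q U (𝓝 0) := squeeze_zero (fun n => (q0 n).le) (fun n => (q1 n).le)
    (tendsto_one_div_add_atTop_nhds_zero_nat.mono_left hU)
  by_cases hR : ∃ R, ∀ᶠ i in (U : Filter ℕ), ξ i ≤ R
  · left
    obtain ⟨R, hR⟩ := hR
    obtain ⟨Φ, Ψ, Φ1, Ψ1, hZ, t1, -⟩ := compactZ g U (s := fun _ => s) (s0 := s)
      (Eventually.of_forall fun n => ⟨hs, h n⟩) (Eventually.of_forall b1) (Eventually.of_forall b2)
      tp tq tendsto_const_nhds
    have hR1 : 0 < max R 1 := lt_max_of_lt_right one_pos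
    refine ⟨Φ, Ψ, Φ1, Ψ1, hZ, max R 1, hR1, ?_⟩
    have : P.u / 2 ≤ Φ (max R 1) := by
      refine ge_of_tendsto (t1 _ hR1) ?_
      filter_upwards [hR] with i hi
      rw [← e i]
      exact (h i).mφ (hξ i) hR1 (hi.trans (le_max_left _ _))
    linarith
  · right
    push Not at hR
    have hR' : ∀ R, ∀ᶠ i in (U : Filter ℕ), R < ξ i := by
      intro R
      have := hR R
      exact this
    obtain ⟨Φ, Ψ, Φ1, Ψ1, hM, t1, -⟩ := compact g U (s := fun _ => s) (s0 := s) (D0 := univ)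
      (Eventually.of_forall fun n => ⟨hs, (h n).shift (ξ n)⟩) tendsto_const_nhds isOpen_univ
      isUpperSet_univ (fun x _ => by
        filter_upwards [hR' (-x)] with i hi
        simp only [mem_setOf_eq, mem_Ioi]; linarith)
    refine ⟨Φ, Ψ, Φ1, Ψ1, hM, ?_⟩
    have := t1 0 trivial
    simp only [zero_add, e] at this
    exact tendsto_nhds_unique this tendsto_const_nhds

lemma excl {P : Par} (g : Good P) {s s' : ℝ} (hs' : 0 ≤ s') (hss : s' ≤ s) (hS : SS P s)
    (hT : TT P s') : False := by
  obtain ⟨φ, ψ, φ1, ψ1, hZ, x, hx, hpx⟩ := hS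
  obtain ⟨Φ, Ψ, Φ1, Ψ1, hM, h0⟩ := hT
  have hu := g.u
  have pos := hM.posD g hs' (x1 := 0) (x2 := 0) trivial trivial (by linarith) (by linarith)
  obtain ⟨l1, l2⟩ := hM.lim_top g hs' (x0 := 0) trivial (by linarith)
  obtain ⟨l3, -⟩ := hM.lim_bot g hs' (x0 := 0) (by linarith)
  obtain ⟨t, ht⟩ := (l3.eventually (gt_mem_nhds (by linarith : 0 < φ x / 2))).exists
  have := (slide g hs' hss (A := t - x - 1) (hM.restrict isOpen_Ioi (isUpperSet_Ioi _)
    (subset_univ _)) hZ.ms (fun x _ => pos x trivial) l1 l2 hZ.z1 hZ.z2 hZ.cont hZ.swap.cont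
    (k := 2) (by norm_num) (t := t - x) (by linarith) x hx).1
  rw [add_sub_cancel] at this
  linarith

lemma TT_closed {P : Par} (g : Good P) {ι : Type*} (U : Ultrafilter ι) {s : ι → ℝ} {s0 : ℝ}
    (h : ∀ᶠ i in (U : Filter ι), 0 ≤ s i ∧ TT P (s i)) (hs : Tendsto s U (𝓝 s0)) : TT P s0 := by
  have hex : ∀ i, ∃ φ ψ φ1 ψ1 : ℝ → ℝ, TT P (s i) → MS P (s i) univ φ ψ φ1 ψ1 ∧ φ 0 = P.u / 2 := by
    intro i
    by_cases hi : TT P (s i)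
    · obtain ⟨φ, ψ, φ1, ψ1, h⟩ := hi
      exact ⟨φ, ψ, φ1, ψ1, fun _ => h⟩
    · exact ⟨0, 0, 0, 0, fun h => absurd h hi⟩
  choose φ ψ φ1 ψ1 hh using hex
  obtain ⟨Φ, Ψ, Φ1, Ψ1, hM, t1, -⟩ := compact g U (s := s) (s0 := s0) (D0 := univ)
      (h.mono fun n hn => ⟨hn.1, (hh n hn.2).1⟩) hs isOpen_univ
      isUpperSet_univ (fun x _ => Eventually.of_forall fun _ => trivial)
  refine ⟨Φ, Ψ, Φ1, Ψ1, hM, ?_⟩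
  refine tendsto_nhds_unique (t1 0 trivial) (tendsto_const_nhds.congr' ?_)
  filter_upwards [h] with i hi
  exact ((hh i hi.2).2).symm

lemma not_TT0 {P : Par} (g : Good P) : ¬ TT P 0 := by
  rintro ⟨φ, ψ, φ1, ψ1, h, h0⟩
  have ha := g.a
  have hb := g.b
  have hc := g.c
  have hd := g.d
  have hd1 := g.d1
  have hd2 := g.d2
  have hu := g.u
  have hr : P.d / P.b < P.c / P.a := by
    rw [div_lt_div_iff₀ hb ha]; linarith [g.bcad]
  obtain ⟨r, r1, r2⟩ := exists_between hr
  have r0 : 0 < r := lt_trans (by positivity) r1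
  rw [div_lt_iff₀ hb] at r1
  rw [lt_div_iff₀ ha] at r2
  obtain ⟨δ1, δ1p, k1⟩ := g.sF ((P.c - r * P.a) / r) (div_pos (by linarith) r0)
  obtain ⟨δ2, δ2p, k2⟩ := g.sG (r * P.b - P.d) (by linarith)
  obtain ⟨l1, l2⟩ := h.lim_bot g le_rfl (x0 := 0) (by linarith)
  obtain ⟨X, hX1, hX2⟩ := ((l1.eventually (gt_mem_nhds δ1p)).and
    (l2.eventually (gt_mem_nhds δ2p))).exists
  have sm := (h.strict g le_rfl (x1 := 0) (x2 := 0) trivial trivial (by linarith) (by linarith)).1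
  let W : ℝ → ℝ := fun x => r * P.d1 * φ x + P.d2 * ψ x
  let W1 : ℝ → ℝ := fun x => r * P.d1 * φ1 x + P.d2 * ψ1 x
  have hW : ∀ x, HasDerivAt W (W1 x) x := fun x =>
    ((h.hφ x trivial).const_mul _).add ((h.hψ x trivial).const_mul _)
  have hW1 : ∀ x, HasDerivAt W1 (r * (P.a * φ x - P.b * ψ x + P.F (φ x)) +
      (P.d * ψ x - P.c * φ x + P.G (ψ x))) x := fun x => by
    refine (((h.hφ1 x trivial).const_mul (r * P.d1)).add
      ((h.hψ1 x trivial).const_mul P.d2)).congr_deriv ?_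
    field_simp; ring
  have anti : AntitoneOn W1 (Iic X) := by
    refine antitoneOn_of_deriv_nonpos (convex_Iic X)
      (fun x _ => (hW1 x).continuousAt.continuousWithinAt)
      (fun x _ => (hW1 x).differentiableAt.differentiableWithinAt) ?_
    intro x hx
    rw [interior_Iic] at hx
    rw [(hW1 x).deriv]
    have p1 := (h.rφ x trivial).1
    have p2 := (h.rψ x trivial).1
    have q1 := k1 (φ x) p1 ((h.mφ trivial trivial (le_of_lt hx)).trans hX1.le)
    have q2 := k2 (ψ x) p2 ((h.mψ trivial trivial (le_of_lt hx)).trans hX2.le)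
    have q3 := mul_le_mul_of_nonneg_left q1 r0.le
    have e : r * ((P.c - r * P.a) / r * φ x) = (P.c - r * P.a) * φ x := by field_simp
    rw [e] at q3
    nlinarith
  obtain ⟨y, hy, he⟩ := exists_hasDerivAt_eq_slope W W1 (show X - 1 < X by linarith)
    (fun x _ => (hW x).continuousAt.continuousWithinAt) (fun x _ => hW x)
  have hw : 0 < W1 y := by
    rw [he]
    have m1 : φ (X - 1) < φ X := sm trivial trivial (by linarith)
    have m2 : ψ (X - 1) ≤ ψ X := h.mψ trivial trivial (by linarith)
    have := mul_lt_mul_of_pos_left m1 (mul_pos r0 hd1)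
    have := mul_le_mul_of_nonneg_left m2 hd2.le
    refine div_pos ?_ (by linarith)
    simp only [W]; linarith
  set w := W1 y
  have hWnn : ∀ x, 0 ≤ W x := fun x => by
    have p1 := (h.rφ x trivial).1
    have p2 := (h.rψ x trivial).1
    simp only [W]; positivity
  have hz : y - (W y / w + 1) < y := by
    have := div_nonneg (hWnn y) hw.le
    linarith
  obtain ⟨η, hη, he2⟩ := exists_hasDerivAt_eq_slope W W1 hz
    (fun x _ => (hW x).continuousAt.continuousWithinAt) (fun x _ => hW x)
  have h3 : w ≤ W1 η := anti (show η ≤ X by linarith [hη.2, hy.2]) (show y ≤ X from hy.2.le) hη.2.le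
  rw [he2, le_div_iff₀ (by linarith)] at h3
  have h4 := hWnn (y - (W y / w + 1))
  have e : w * (y - (y - (W y / w + 1))) = W y + w := by field_simp; ring
  rw [e] at h3
  linarith

lemma bd_half {P : Par} (g : Good P) {s M x : ℝ} {φ ψ φ1 ψ1 : ℝ → ℝ}
    (h : MS P s (Ioi 0) φ ψ φ1 ψ1) (hs : P.d1 + P.b < s) (hM : 0 < M) (hx : 0 < x)
    (h1 : ∀ y > 0, φ y ≤ M * Real.exp y) (h2 : φ x = M * Real.exp x) (h3 : ψ x ≤ φ x) : False := by
  have hmin : IsLocalMin (fun y => M * Real.exp y - φ y) x := by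
    filter_upwards [lt_mem_nhds hx] with y hy
    have := h1 y hy
    linarith
  have := second_test (w1 := fun y => M * Real.exp y - φ1 y) hmin (by
      filter_upwards [lt_mem_nhds hx] with y hy
      exact ((Real.hasDerivAt_exp y).const_mul M).sub (h.hφ y hy))
    (((Real.hasDerivAt_exp x).const_mul M).sub (h.hφ1 x hx))
  obtain ⟨e1, e2⟩ := this
  have hp : 0 < φ x := by rw [h2]; positivity
  have e3 : φ1 x = φ x := by linarith
  rw [← h2, e3] at e2
  have e4 : (s * φ x + P.a * φ x - P.b * ψ x + P.F (φ x)) / P.d1 ≤ φ x := by linarith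
  rw [div_le_iff₀ g.d1] at e4
  have := g.Fnn hp.le
  have := mul_pos g.a hp
  have := mul_le_mul_of_nonneg_left h3 g.b.le
  nlinarith

lemma not_SS_big {P : Par} (g : Good P) {s : ℝ} (h1 : P.d1 + P.b < s) (h2 : P.d2 + P.c < s) :
    ¬ SS P s := by
  have hs : 0 ≤ s := by have := g.d1; have := g.b; linarith
  rintro ⟨φ, ψ, φ1, ψ1, h, x1, hx1, hp⟩
  obtain ⟨-, -, l1, l2⟩ := h.props g hs hx1 hp
  let w : ℝ → ℝ := fun x => max (φ x) (ψ x) * Real.exp (-x)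
  have hw1 : 0 < w x1 := mul_pos (lt_max_of_lt_left hp) (Real.exp_pos _)
  have lw : Tendsto w atTop (𝓝 (max P.u P.v * 0)) :=
    (l1.max l2).mul (Real.tendsto_exp_neg_atTop_nhds_zero)
  rw [mul_zero] at lw
  obtain ⟨X, hX⟩ := eventually_atTop.1 (lw.eventually (gt_mem_nhds hw1))
  have cw : ContinuousOn w (Ici 0) := by
    have c1 := h.cont
    have c2 := h.swap.cont
    have : ContinuousOn (fun x : ℝ => Real.exp (-x)) (Ici 0) := by fun_prop
    exact (c1.sup c2).mul this
  obtain ⟨x, hx, hmax⟩ := (isCompact_Icc (a := 0) (b := max X x1)).exists_isMaxOn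
    ⟨x1, hx1.le, le_max_right _ _⟩ (cw.mono Icc_subset_Ici_self)
  have hwx : w x1 ≤ w x := hmax ⟨hx1.le, le_max_right _ _⟩
  have hall : ∀ y > 0, w y ≤ w x := by
    intro y hy
    rcases le_total y (max X x1) with c | c
    · exact hmax ⟨hy.le, c⟩
    · exact (hX y ((le_max_left _ _).trans c)).le.trans hwx
  have hM : 0 < w x := hw1.trans_le hwx
  have hx0 : 0 < x := by
    refine lt_of_le_of_ne hx.1 fun e => ?_
    rw [← e] at hM
    simp [w, h.z1, h.z2] at hM
  have key : ∀ y, max (φ y) (ψ y) = w y * Real.exp y := by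
    intro y
    simp only [w]
    rw [mul_assoc, ← Real.exp_add]; simp
  have le1 : ∀ y > 0, max (φ y) (ψ y) ≤ w x * Real.exp y := by
    intro y hy
    rw [key]
    exact mul_le_mul_of_nonneg_right (hall y hy) (Real.exp_pos _).le
  rcases le_total (ψ x) (φ x) with c | c
  · exact bd_half g h.ms h1 hM hx0 (fun y hy => (le_max_left _ _).trans (le1 y hy))
      (by rw [← key, max_eq_left c]) c
  · exact bd_half g.swap h.ms.swap h2 hM hx0 (fun y hy => (le_max_right _ _).trans (le1 y hy))
      (by rw [← key, max_eq_right c]) c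

lemma SS_down {P : Par} (g : Good P) {s s' : ℝ} (hs' : 0 ≤ s') (hss : s' ≤ s) (hS : SS P s) :
    SS P s' := (dich g hs').resolve_right fun h => excl g hs' hss hS h

lemma exists_sstar {P : Par} (g : Good P) : ∃ S > 0, (∀ s, 0 ≤ s → s < S → SS P s) ∧
    ∀ s, S ≤ s → ¬ SS P s := by
  let A : Set ℝ := {s | 0 ≤ s ∧ SS P s}
  have h0 : (0:ℝ) ∈ A := ⟨le_rfl, (dich g le_rfl).resolve_right (not_TT0 g)⟩
  have hbd : BddAbove A := by
    refine ⟨P.d1 + P.b + P.d2 + P.c, fun s hs => ?_⟩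
    by_contra hlt
    push Not at hlt
    have := g.d1
    have := g.d2
    have := g.b
    have := g.c
    exact not_SS_big g (by linarith) (by linarith) hs.2
  have hS0 : 0 ≤ sSup A := le_csSup hbd h0
  have low : ∀ s, 0 ≤ s → s < sSup A → SS P s := by
    intro s hs hlt
    obtain ⟨t, ht, hst⟩ := exists_lt_of_lt_csSup ⟨0, h0⟩ hlt
    exact SS_down g hs hst.le ht.2
  have nS : ¬ SS P (sSup A) := by
    intro hS
    let U : Ultrafilter ℝ := Ultrafilter.of (𝓝[>] (sSup A))
    have hU : (U : Filter ℝ) ≤ 𝓝[>] (sSup A) := Ultrafilter.of_le _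
    refine excl g hS0 le_rfl hS (TT_closed g U (s := id) ?_ (hU.trans nhdsWithin_le_nhds))
    refine hU ?_
    filter_upwards [self_mem_nhdsWithin] with s hs
    have hs0 : 0 ≤ s := hS0.trans (le_of_lt hs)
    exact ⟨hs0, (dich g hs0).resolve_left fun h => not_le_of_gt hs (le_csSup hbd ⟨hs0, h⟩)⟩
  refine ⟨sSup A, ?_, low, fun s hs h => nS (SS_down g hS0 hs h)⟩
  refine lt_of_le_of_ne hS0 fun e => nS ?_
  rw [← e]; exact h0.2

lemma lip_lim {f : ℝ → ℝ} {C : ℝ} (h : ∀ x > 0, ∀ y > 0, |f x - f y| ≤ C * |x - y|) :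
    ∃ A, Tendsto f (𝓝[>] 0) (𝓝 A) ∧ ∀ x > 0, |f x - A| ≤ C * x := by
  have hl : LipschitzOnWith C.toNNReal f (Ioi 0) := LipschitzOnWith.of_dist_le' h
  obtain ⟨k, hk, he⟩ := hl.extend_real
  have t : Tendsto f (𝓝[>] 0) (𝓝 (k 0)) := by
    refine (hk.continuous.continuousAt.mono_left nhdsWithin_le_nhds).congr' ?_
    filter_upwards [self_mem_nhdsWithin] with x hx using (he hx).symm
  refine ⟨k 0, t, fun x hx => ?_⟩
  have t2 : Tendsto (fun y => |f x - f y|) (𝓝[>] 0) (𝓝 |f x - k 0|) := (t.const_sub _).abs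
  have t3 : Tendsto (fun y => C * |x - y|) (𝓝[>] 0) (𝓝 (C * |x - 0|)) := by
    have : Continuous (fun y => C * |x - y|) := by fun_prop
    exact this.continuousAt.mono_left nhdsWithin_le_nhds
  rw [sub_zero, abs_of_pos hx] at t3
  refine le_of_tendsto_of_tendsto t2 t3 ?_
  filter_upwards [self_mem_nhdsWithin] with y hy using h x hx y hy

lemma deriv_bdry {f f1 : ℝ → ℝ} {A : ℝ} (h : ∀ x > 0, HasDerivAt f (f1 x) x)
    (t : Tendsto f (𝓝[>] 0) (𝓝 (f 0))) (t1 : Tendsto f1 (𝓝[>] 0) (𝓝 A)) :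
    HasDerivWithinAt f A (Ici 0) 0 := by
  refine hasDerivWithinAt_Ici_of_tendsto_deriv (s := Ioi 0)
    (fun x hx => (h x hx).differentiableAt.differentiableWithinAt) t self_mem_nhdsWithin
    (t1.congr' ?_)
  filter_upwards [self_mem_nhdsWithin] with x hx using (h x hx).deriv.symm

lemma c1_of {f f1 : ℝ → ℝ} (h : ∀ x > 0, HasDerivAt f (f1 x) x)
    (t : Tendsto f (𝓝[>] 0) (𝓝 (f 0))) (t1 : Tendsto f1 (𝓝[>] 0) (𝓝 (f1 0))) :
    ∀ x ∈ Ici (0:ℝ), HasDerivWithinAt f (f1 x) (Ici 0) x := by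
  intro x hx
  rcases eq_or_lt_of_le (mem_Ici.1 hx) with h0 | h0
  · subst h0; exact deriv_bdry h t t1
  · exact (h x h0).hasDerivWithinAt

lemma c2_of {f f1 f2 : ℝ → ℝ} (h : ∀ x > 0, HasDerivAt f (f1 x) x)
    (h1 : ∀ x > 0, HasDerivAt f1 (f2 x) x) (h2 : ∀ x > 0, ContinuousAt f2 x)
    (t : Tendsto f (𝓝[>] 0) (𝓝 (f 0))) (t1 : Tendsto f1 (𝓝[>] 0) (𝓝 (f1 0)))
    (t2 : Tendsto f2 (𝓝[>] 0) (𝓝 (f2 0))) : ContDiffOn ℝ 2 f (Ici 0) := by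
  have ud : UniqueDiffOn ℝ (Ici (0:ℝ)) := uniqueDiffOn_Ici 0
  have a := c1_of h t t1
  have b := c1_of h1 t1 t2
  have e1 : (2 : WithTop ℕ∞) = 1 + 1 := by norm_num
  rw [e1, contDiffOn_succ_iff_derivWithin ud]
  refine ⟨fun x hx => (a x hx).differentiableWithinAt, by simp, ?_⟩
  have : ContDiffOn ℝ 1 f1 (Ici 0) := by
    rw [contDiffOn_one_iff_derivWithin ud]
    refine ⟨fun x hx => (b x hx).differentiableWithinAt, ?_⟩
    have c : ContinuousOn f2 (Ici 0) := by
      intro x hx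
      rcases eq_or_lt_of_le (mem_Ici.1 hx) with h0 | h0
      · subst h0; exact continuousWithinAt_Ioi_iff_Ici.1 t2
      · exact (h2 x h0).continuousWithinAt
    exact c.congr fun x hx => (b x hx).derivWithin (ud x hx)
  exact this.congr fun x hx => (a x hx).derivWithin (ud x hx)

def dW (φ : ℝ → ℝ) : ℝ := derivWithin φ (Ici 0) 0

lemma Z0.bdry {P : Par} (g : Good P) {s S : ℝ} (hs : 0 ≤ s) (hS : s ≤ S) {φ ψ φ1 ψ1 : ℝ → ℝ}
    (h : Z0 P s φ ψ φ1 ψ1) : HasDerivWithinAt φ (dW φ) (Ici 0) 0 ∧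
      Tendsto φ1 (𝓝[>] 0) (𝓝 (dW φ)) ∧ (∀ x > 0, |φ1 x - dW φ| ≤ P.C2 S * x) ∧ 0 ≤ dW φ := by
  obtain ⟨A, t, b⟩ := lip_lim (f := φ1) (C := P.C2 S) (fun x hx y hy => h.ms.φ1_lip g hs hS hx hy)
  have hd := deriv_bdry h.ms.hφ (by rw [h.z1]; exact h.tend) t
  have e : dW φ = A := hd.derivWithin (uniqueDiffOn_Ici (0:ℝ) 0 (mem_Ici.2 le_rfl))
  rw [e]
  refine ⟨hd, t, b, ge_of_tendsto t ?_⟩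
  filter_upwards [self_mem_nhdsWithin] with x hx using h.ms.φ1_nn hx

lemma Z0.c2 {P : Par} (g : Good P) {s : ℝ} (hs : 0 ≤ s) {φ ψ φ1 ψ1 : ℝ → ℝ}
    (h : Z0 P s φ ψ φ1 ψ1) : ContDiffOn ℝ 2 φ (Ici 0) := by
  obtain ⟨-, t1, -⟩ := h.bdry g hs le_rfl
  let R : ℝ → ℝ := fun x => (s * φ1 x + P.a * φ x - P.b * ψ x + P.F (φ x)) / P.d1
  have tR : ∀ {l : Filter ℝ} {y y1 z : ℝ}, (∀ᶠ x in l, φ x ∈ Icc 0 P.u) → y ∈ Icc 0 P.u →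
      Tendsto φ l (𝓝 y) →
      Tendsto φ1 l (𝓝 y1) → Tendsto ψ l (𝓝 z) →
      Tendsto R l (𝓝 ((s * y1 + P.a * y - P.b * z + P.F y) / P.d1)) := by
    intro l y y1 z h0 h1 h2 h3 h4
    exact ((((h3.const_mul s).add (h2.const_mul _)).sub (h4.const_mul _)).add
      (tendsto_F g h0 h1 h2)).div_const _
  have hR := tR (l := 𝓝[>] 0) (by filter_upwards [self_mem_nhdsWithin] with x hx using h.ms.rφ x hx)
    ⟨le_rfl, g.u.le⟩ h.tend t1 h.swap.tend
  set B := (s * dW φ + P.a * 0 - P.b * 0 + P.F 0) / P.d1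
  have ev : ∀ x : ℝ, 0 < x → ∀ᶠ y in 𝓝 x, 0 < y := fun x hx => lt_mem_nhds hx
  refine c2_of (f1 := fun x => if 0 < x then φ1 x else dW φ) (f2 := fun x => if 0 < x then R x else B)
    ?_ ?_ ?_ ?_ ?_ ?_
  · intro x hx
    rw [if_pos hx]; exact h.ms.hφ x hx
  · intro x hx
    rw [if_pos hx]
    refine (h.ms.hφ1 x hx).congr_of_eventuallyEq ?_
    filter_upwards [ev x hx] with y hy using if_pos hy
  · intro x hx
    have : ContinuousAt R x := tR (by filter_upwards [ev x hx] with y hy using h.ms.rφ y hy)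
      (h.ms.rφ x hx) (h.ms.hφ x hx).continuousAt (h.ms.hφ1 x hx).continuousAt
      (h.ms.hψ x hx).continuousAt
    refine this.congr ?_
    filter_upwards [ev x hx] with y hy using (if_pos hy).symm
  · rw [h.z1]; exact h.tend
  · rw [if_neg (lt_irrefl _)]
    refine t1.congr' ?_
    filter_upwards [self_mem_nhdsWithin] with y hy using (if_pos hy).symm
  · rw [if_neg (lt_irrefl _)]
    refine hR.congr' ?_
    filter_upwards [self_mem_nhdsWithin] with y hy using (if_pos hy).symm

lemma Z0.comp {P : Par} (g : Good P) {s s' : ℝ} (hs' : 0 ≤ s') (hss : s' ≤ s)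
    {φ ψ φ1 ψ1 Φ Ψ Φ1 Ψ1 : ℝ → ℝ} (h : Z0 P s φ ψ φ1 ψ1) (H : Z0 P s' Φ Ψ Φ1 Ψ1)
    (hp : ∃ x > 0, 0 < Φ x) : ∀ x > 0, φ x ≤ Φ x ∧ ψ x ≤ Ψ x := by
  obtain ⟨x1, hx1, hp⟩ := hp
  obtain ⟨-, pos, l1, l2⟩ := H.props g hs' hx1 hp
  intro x hx
  have key : ∀ t > 0, φ x ≤ (1 + t) * Φ (x + t) ∧ ψ x ≤ (1 + t) * Ψ (x + t) := fun t ht =>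
    slide g hs' hss H.ms h.ms pos l1 l2 h.z1 h.z2 h.cont h.swap.cont (k := 1 + t) (by linarith) ht x hx
  have aux : ∀ {f : ℝ → ℝ}, ContinuousAt f x →
      Tendsto (fun t => (1 + t) * f (x + t)) (𝓝[>] 0) (𝓝 (f x)) := by
    intro f hf
    have h1 : ContinuousAt (fun t => (1 + t) * f (x + t)) 0 := by
      have : ContinuousAt (fun t => f (x + t)) 0 := by
        refine ContinuousAt.comp (g := f) (f := fun t => x + t) ?_ (by fun_prop)
        simpa using hf
      exact (continuousAt_const.add continuousAt_id).mul this
    have h2 := h1.tendsto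
    simp only [add_zero, one_mul] at h2
    exact h2.mono_left nhdsWithin_le_nhds
  constructor
  · refine ge_of_tendsto (aux (H.ms.hφ x hx).continuousAt) ?_
    filter_upwards [self_mem_nhdsWithin] with t ht using (key t ht).1
  · refine ge_of_tendsto (aux (H.ms.hψ x hx).continuousAt) ?_
    filter_upwards [self_mem_nhdsWithin] with t ht using (key t ht).2

lemma Z0.uniq {P : Par} (g : Good P) {s : ℝ} (hs : 0 ≤ s)
    {φ ψ φ1 ψ1 Φ Ψ Φ1 Ψ1 : ℝ → ℝ} (h : Z0 P s φ ψ φ1 ψ1) (H : Z0 P s Φ Ψ Φ1 Ψ1)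
    (hp : ∃ x > 0, 0 < φ x) (Hp : ∃ x > 0, 0 < Φ x) : EqOn φ Φ (Ici 0) ∧ EqOn ψ Ψ (Ici 0) := by
  have a := h.comp g hs le_rfl H Hp
  have b := H.comp g hs le_rfl h hp
  constructor
  · intro x hx
    rcases eq_or_lt_of_le (mem_Ici.1 hx) with h0 | h0
    · subst h0; rw [h.z1, H.z1]
    · exact le_antisymm (a x h0).1 (b x h0).1
  · intro x hx
    rcases eq_or_lt_of_le (mem_Ici.1 hx) with h0 | h0
    · subst h0; rw [h.z2, H.z2]
    · exact le_antisymm (a x h0).2 (b x h0).2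

lemma dW_congr {f f' : ℝ → ℝ} (h : EqOn f f' (Ici 0)) : dW f = dW f' :=
  derivWithin_congr h (h (mem_Ici.2 le_rfl))

lemma dW_le {f f' : ℝ → ℝ} (h : HasDerivWithinAt f (dW f) (Ici 0) 0)
    (h' : HasDerivWithinAt f' (dW f') (Ici 0) 0) (z : f 0 = 0) (z' : f' 0 = 0)
    (le : ∀ x > 0, f x ≤ f' x) : dW f ≤ dW f' := by
  have a := (hasDerivWithinAt_iff_tendsto_slope' self_notMem_Ioi).1 (h.mono Ioi_subset_Ici_self)
  have b := (hasDerivWithinAt_iff_tendsto_slope' self_notMem_Ioi).1 (h'.mono Ioi_subset_Ici_self)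
  refine le_of_tendsto_of_tendsto a b ?_
  filter_upwards [self_mem_nhdsWithin] with x hx
  have hx : 0 < x := hx
  rw [slope_def_field, slope_def_field, z, z', sub_zero, sub_zero, sub_zero]
  exact (div_le_div_iff_of_pos_right hx).2 (le x hx)

lemma dW_tendsto {P : Par} (g : Good P) {ι : Type*} (U : Ultrafilter ι) {s : ι → ℝ}
    {φ ψ φ1 ψ1 : ι → ℝ → ℝ} {s0 S : ℝ} {Φ Ψ Φ1 Ψ1 : ℝ → ℝ} (hs0 : 0 ≤ s0) (hs0S : s0 ≤ S)
    (h : ∀ᶠ i in (U : Filter ι), 0 ≤ s i ∧ s i ≤ S ∧ Z0 P (s i) (φ i) (ψ i) (φ1 i) (ψ1 i))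
    (H : Z0 P s0 Φ Ψ Φ1 Ψ1) (t : ∀ x > 0, Tendsto (fun i => φ1 i x) U (𝓝 (Φ1 x))) :
    Tendsto (fun i => dW (φ i)) U (𝓝 (dW Φ)) := by
  rw [Metric.tendsto_nhds]
  intro ε hε
  obtain ⟨-, -, B, -⟩ := H.bdry g hs0 hs0S
  have hC : ∃ x > 0, P.C2 S * x < ε / 4 := by
    have : Tendsto (fun x => P.C2 S * x) (𝓝[>] 0) (𝓝 (P.C2 S * 0)) :=
      (continuous_const_mul _).continuousAt.mono_left nhdsWithin_le_nhds
    rw [mul_zero] at this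
    obtain ⟨x, h1, h2⟩ := ((this.eventually (gt_mem_nhds (by linarith : 0 < ε / 4))).and
      self_mem_nhdsWithin).exists
    exact ⟨x, h2, h1⟩
  obtain ⟨x, hx, hxε⟩ := hC
  have := (Metric.tendsto_nhds.1 (t x hx)) (ε / 4) (by linarith)
  filter_upwards [h, this] with i hi h2
  obtain ⟨-, -, b, -⟩ := hi.2.2.bdry g hi.1 hi.2.1
  have b1 := b x hx
  have b2 := B x hx
  rw [Real.dist_eq] at *
  rw [abs_le] at b1 b2
  rw [abs_lt] at *
  constructor <;> linarith

lemma speed_mono {P : Par} (g : Good P) {s s' ρ : ℝ} (hρ : 0 < ρ) (hs' : 0 ≤ s') (hss : s' ≤ s)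
    {φ ψ φ1 ψ1 Φ Ψ Φ1 Ψ1 : ℝ → ℝ} (h : Z0 P s φ ψ φ1 ψ1) (H : Z0 P s' Φ Ψ Φ1 Ψ1)
    (hp : ∃ x > 0, 0 < Φ x) : dW ψ + ρ * dW φ ≤ dW Ψ + ρ * dW Φ := by
  have cc := h.comp g hs' hss H hp
  have hs := hs'.trans hss
  have a := dW_le (h.bdry g hs le_rfl).1 (H.bdry g hs' le_rfl).1 h.z1 H.z1 (fun x hx => (cc x hx).1)
  have b := dW_le (h.swap.bdry g.swap hs le_rfl).1 (H.swap.bdry g.swap hs' le_rfl).1 h.z2 H.z2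
    (fun x hx => (cc x hx).2)
  have := mul_le_mul_of_nonneg_left a hρ.le
  linarith

lemma speed_pos {P : Par} (g : Good P) {s ρ : ℝ} (hρ : 0 < ρ) (hs : 0 ≤ s)
    {φ ψ φ1 ψ1 : ℝ → ℝ} (h : Z0 P s φ ψ φ1 ψ1) (hp : ∃ x > 0, 0 < φ x) :
    0 < dW ψ + ρ * dW φ := by
  obtain ⟨-, t1, -, n1⟩ := h.bdry g hs le_rfl
  obtain ⟨-, t2, -, n2⟩ := h.swap.bdry g.swap hs le_rfl
  by_contra hn
  push Not at hn
  have m := mul_nonneg hρ.le n1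
  have e2 : dW ψ = 0 := by linarith
  have e1 : dW φ = 0 := by
    have : ρ * dW φ = 0 := by linarith
    exact (mul_eq_zero.1 this).resolve_left hρ.ne'
  rw [e1] at t1
  rw [e2] at t2
  obtain ⟨x, hx, hx0⟩ := hp
  exact hx0.ne' (h.ms.uniq0 g hs h.tend h.swap.tend t1 t2 x hx)

lemma dW_zero {f : ℝ → ℝ} (h : ∀ x > 0, f x = 0) (z : f 0 = 0) : dW f = 0 := by
  have : EqOn f (fun _ => (0:ℝ)) (Ici 0) := by
    intro x hx
    rcases eq_or_lt_of_le (mem_Ici.1 hx) with h0 | h0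
    · subst h0; exact z
    · exact h x h0
  rw [dW_congr this]
  simp [dW]

lemma Z0.triv {P : Par} (g : Good P) {s ρ : ℝ} (hs : 0 ≤ s)
    {φ ψ φ1 ψ1 : ℝ → ℝ} (h : Z0 P s φ ψ φ1 ψ1) (hp : ¬ ∃ x > 0, 0 < φ x) :
    dW ψ + ρ * dW φ = 0 := by
  push Not at hp
  have e : ∀ x > 0, φ x = 0 := fun x hx => le_antisymm (hp x hx) (h.ms.rφ x hx).1
  have e' : ∀ x > 0, ψ x = 0 := by
    have := h.ms.flat g hs (x := 1) (y := 2) (by simp) (by norm_num)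
      (by rw [e 1 one_pos, e 2 two_pos])
    rcases this with k | k
    · exact fun x hx => (k x hx).2
    · have := (k 1 (by simp)).1
      rw [e 1 one_pos] at this
      exact absurd this g.u.ne
  rw [dW_zero e h.z1, dW_zero e' h.z2]; ring

lemma speed_exists {P : Par} (g : Good P) {S μ ρ : ℝ} (hμ : 0 < μ) (hρ : 0 < ρ) (hS : 0 < S)
    (low : ∀ s, 0 ≤ s → s < S → SS P s) (high : ¬ SS P S) :
    ∃ s ∈ Ioo 0 S, ∃ φ ψ φ1 ψ1 : ℝ → ℝ, Z0 P s φ ψ φ1 ψ1 ∧ (∃ x > 0, 0 < φ x) ∧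
      μ * (dW ψ + ρ * dW φ) = s := by
  have ex : ∀ s, ∃ φ ψ φ1 ψ1 : ℝ → ℝ, 0 ≤ s → s < S → Z0 P s φ ψ φ1 ψ1 ∧ ∃ x > 0, 0 < φ x := by
    intro s
    by_cases h : 0 ≤ s ∧ s < S
    · obtain ⟨φ, ψ, φ1, ψ1, hh⟩ := low s h.1 h.2
      exact ⟨φ, ψ, φ1, ψ1, fun _ _ => hh⟩
    · exact ⟨0, 0, 0, 0, fun h1 h2 => absurd ⟨h1, h2⟩ h⟩
  choose φ ψ φ1 ψ1 hz using ex
  let Θ : ℝ → ℝ := fun s => dW (ψ s) + ρ * dW (φ s)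
  have lim : ∀ s0, 0 ≤ s0 → s0 ≤ S → ∀ U : Ultrafilter ℝ, (U : Filter ℝ) ≤ 𝓝[Ico 0 S] s0 →
      ∃ Φ Ψ Φ1 Ψ1 : ℝ → ℝ, Z0 P s0 Φ Ψ Φ1 Ψ1 ∧
        (∀ x > 0, Tendsto (fun i => φ i x) U (𝓝 (Φ x))) ∧
        Tendsto Θ U (𝓝 (dW Ψ + ρ * dW Φ)) := by
    intro s0 h0 h1 U hU
    have ev : ∀ᶠ i in (U : Filter ℝ), i ∈ Ico 0 S := hU self_mem_nhdsWithin
    obtain ⟨Φ, Ψ, Φ1, Ψ1, hZ, t1, t2, t3, t4⟩ := compactZ g U (s := id) (s0 := s0)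
      (φ := φ) (ψ := ψ) (φ1 := φ1) (ψ1 := ψ1) (p := fun _ => 0) (q := fun _ => 0)
      (by filter_upwards [ev] with i hi using ⟨hi.1, (hz i hi.1 hi.2).1.ms⟩)
      (by filter_upwards [ev] with i hi x hx
          rw [zero_add]; exact (hz i hi.1 hi.2).1.b1 x hx)
      (by filter_upwards [ev] with i hi x hx
          rw [zero_add]; exact (hz i hi.1 hi.2).1.b2 x hx)
      tendsto_const_nhds tendsto_const_nhds (hU.trans nhdsWithin_le_nhds)
    refine ⟨Φ, Ψ, Φ1, Ψ1, hZ, t1, ?_⟩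
    have A := dW_tendsto g U (s := id) (S := S) h0 h1
      (by filter_upwards [ev] with i hi using ⟨hi.1, hi.2.le, (hz i hi.1 hi.2).1⟩) hZ t3
    have B := dW_tendsto g.swap U (s := id) (S := S) h0 h1
      (by filter_upwards [ev] with i hi using ⟨hi.1, hi.2.le, (hz i hi.1 hi.2).1.swap⟩) hZ.swap t4
    exact B.add (A.const_mul ρ)
  have cont : ContinuousOn Θ (Ico 0 S) := by
    intro s0 hs0
    refine (tendsto_iff_ultrafilter _ _ _).2 fun U hU => ?_
    obtain ⟨Φ, Ψ, Φ1, Ψ1, hZ, t1, tt⟩ := lim s0 hs0.1 hs0.2.le U hU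
    have hp : ∃ x > 0, 0 < Φ x := by
      have hm : s0 < (s0 + S) / 2 ∧ (s0 + S) / 2 < S := by
        have := hs0.2
        constructor <;> linarith
      obtain ⟨zz, x, hx, hxp⟩ := hz ((s0 + S) / 2) (by linarith [hs0.1]) hm.2
      refine ⟨x, hx, lt_of_lt_of_le hxp (ge_of_tendsto (t1 x hx) ?_)⟩
      have e1 : ∀ᶠ i in (U : Filter ℝ), i ∈ Ico 0 S := hU self_mem_nhdsWithin
      have e2 : ∀ᶠ i in (U : Filter ℝ), i < (s0 + S) / 2 :=
        (hU.trans nhdsWithin_le_nhds) (gt_mem_nhds hm.1)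
      filter_upwards [e1, e2] with i i1 i2
      exact (zz.comp g i1.1 i2.le (hz i i1.1 i1.2).1 (hz i i1.1 i1.2).2 x hx).1
    obtain ⟨q, qp⟩ := hz s0 hs0.1 hs0.2
    obtain ⟨E1, E2⟩ := hZ.uniq g hs0.1 q hp qp
    have : Θ s0 = dW Ψ + ρ * dW Φ := by rw [dW_congr E1, dW_congr E2]
    rw [this]; exact tt
  have limS : Tendsto Θ (𝓝[Ico 0 S] S) (𝓝 0) := by
    refine (tendsto_iff_ultrafilter _ _ _).2 fun U hU => ?_
    obtain ⟨Φ, Ψ, Φ1, Ψ1, hZ, t1, tt⟩ := lim S hS.le le_rfl U hU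
    rwa [hZ.triv g hS.le fun hp => high ⟨Φ, Ψ, Φ1, Ψ1, hZ, hp⟩] at tt
  have hne : (𝓝[Ico 0 S] S).NeBot := by
    rw [← mem_closure_iff_nhdsWithin_neBot, closure_Ico hS.ne]
    exact ⟨hS.le, le_rfl⟩
  have ev1 : ∀ᶠ s in 𝓝[Ico 0 S] S, s ∈ Ico 0 S := self_mem_nhdsWithin
  have ev2 : ∀ᶠ s in 𝓝[Ico 0 S] S, S / 2 < s :=
    mem_nhdsWithin_of_mem_nhds (lt_mem_nhds (show S / 2 < S by linarith))
  obtain ⟨s1, h1, h2, h3⟩ := ((limS.eventually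
    (gt_mem_nhds (show 0 < S / (2 * μ) by positivity))).and (ev1.and ev2)).exists
  have h1' : μ * Θ s1 < s1 := by
    have : μ * Θ s1 < μ * (S / (2 * μ)) := mul_lt_mul_of_pos_left h1 hμ
    have e : μ * (S / (2 * μ)) = S / 2 := by field_simp
    have h3 : S / 2 < s1 := h3
    linarith
  have p0 : 0 < Θ 0 := speed_pos g hρ le_rfl (hz 0 le_rfl hS).1 (hz 0 le_rfl hS).2
  have ivt := intermediate_value_Icc' (f := fun s => μ * Θ s - s) h2.1
    (((continuousOn_const.mul cont).sub continuousOn_id).mono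
      (fun x hx => ⟨hx.1, lt_of_le_of_lt hx.2 h2.2⟩))
  have hm : (0:ℝ) ∈ Icc (μ * Θ s1 - s1) (μ * Θ 0 - 0) := by
    have := mul_pos hμ p0
    constructor <;> linarith
  obtain ⟨s, hs, es⟩ := ivt hm
  have es : μ * Θ s - s = 0 := es
  have sS : s < S := lt_of_le_of_lt hs.2 h2.2
  have s0 : 0 < s := by
    rcases eq_or_lt_of_le hs.1 with e | e
    · exfalso
      rw [← e] at es
      have := mul_pos hμ p0
      linarith
    · exact e
  exact ⟨s, ⟨s0, sS⟩, φ s, ψ s, φ1 s, ψ1 s, (hz s s0.le sS).1, (hz s s0.le sS).2, by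
    have : μ * Θ s = s := by linarith
    exact this⟩


lemma lip_of {f : ℝ → ℝ} (h : ContDiffOn ℝ 2 f (Ici 0)) (M : ℝ) :
    ∃ L ≥ 0, ∀ x ∈ Icc 0 M, ∀ y ∈ Icc 0 M, |f x - f y| ≤ L * |x - y| := by
  have hc := h.continuousOn_derivWithin (uniqueDiffOn_Ici 0) (by norm_num)
  obtain ⟨C, hC⟩ := isCompact_Icc.exists_bound_of_continuousOn
    (hc.mono (Icc_subset_Ici_self : Icc 0 M ⊆ Ici 0))
  refine ⟨max C 0, le_max_right _ _, fun x hx y hy => ?_⟩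
  have hd : DifferentiableOn ℝ f (Ici 0) := h.differentiableOn (by norm_num)
  exact (convex_Icc 0 M).norm_image_sub_le_of_norm_hasDerivWithin_le (f := f)
    (f' := derivWithin f (Ici 0))
    (fun z hz => ((hd z hz.1).hasDerivWithinAt).mono Icc_subset_Ici_self)
    (fun z hz => (hC z hz).trans (le_max_left _ _)) hy hx

lemma small_of {f : ℝ → ℝ} (h : ContDiffOn ℝ 2 f (Ici 0)) (z : f 0 = 0)
    (d0 : derivWithin f (Ici 0) 0 = 0) : ∀ ε > 0, ∃ δ > 0, ∀ z, 0 ≤ z → z ≤ δ → f z ≤ ε * z := by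
  intro ε hε
  have hd : DifferentiableOn ℝ f (Ici 0) := h.differentiableOn (by norm_num)
  have h0 := (hd 0 (mem_Ici.2 le_rfl)).hasDerivWithinAt
  rw [d0] at h0
  have := (hasDerivWithinAt_iff_isLittleO.1 h0).def hε
  obtain ⟨δ, hδ, hb⟩ := Metric.mem_nhdsWithin_iff.1 this
  refine ⟨δ / 2, by linarith, fun y hy hy2 => ?_⟩
  have := hb ⟨by rw [Metric.mem_ball, Real.dist_eq, sub_zero, abs_of_nonneg hy]; linarith, hy⟩
  simp only [mem_setOf_eq, z, sub_zero, smul_zero, Real.norm_eq_abs, abs_of_nonneg hy] at this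
  exact (le_abs_self _).trans this

lemma exists_par {d1 d2 a b c d : ℝ}
    (hd1 : 0 < d1) (hd2 : 0 < d2) (ha : 0 < a) (hb : 0 < b) (hc : 0 < c) (hd : 0 < d)
    (hbcad : 0 < b * c - a * d) {F G : ℝ → ℝ} (hA : CondA F G) {u v : ℝ}
    (hEq : IsEquilibrium a b c d F G u v) :
    ∃ L, Good ⟨d1, d2, a, b, c, d, u, v, L, F, G⟩ := by
  obtain ⟨L1, h1, l1⟩ := lip_of hA.regF u
  obtain ⟨L2, h2, l2⟩ := lip_of hA.regG v
  obtain ⟨hu, hv, e1, e2⟩ := hEq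
  refine ⟨max L1 L2, ⟨hd1, hd2, ha, hb, hc, hd, hu, hv, h1.trans (le_max_left _ _), hbcad,
    hA.zeroF, hA.zeroG, hA.monoF, hA.monoG, hA.ratioF, hA.ratioG, ?_, ?_,
    small_of hA.regF hA.zeroF hA.dzeroF, small_of hA.regG hA.zeroG hA.dzeroG, ?_, ?_⟩⟩
  · intro x hx y hy
    exact (l1 x hx y hy).trans (mul_le_mul_of_nonneg_right (le_max_left _ _) (abs_nonneg _))
  · intro x hx y hy
    exact (l2 x hx y hy).trans (mul_le_mul_of_nonneg_right (le_max_right _ _) (abs_nonneg _))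
  · simp only; linarith
  · simp only; linarith

lemma der_of {f : ℝ → ℝ} (h : ContDiffOn ℝ 2 f (Ici 0)) {x : ℝ} (hx : 0 < x) :
    HasDerivAt f (deriv f x) x ∧ HasDerivAt (deriv f) (deriv (deriv f) x) x := by
  have h' := h.mono (Ioi_subset_Ici_self : Ioi (0:ℝ) ⊆ Ici 0)
  have h1 : DifferentiableOn ℝ f (Ioi 0) := h'.differentiableOn (by norm_num)
  have h2 : ContDiffOn ℝ 1 (deriv f) (Ioi 0) := h'.deriv_of_isOpen isOpen_Ioi (by norm_num)
  have h3 : DifferentiableOn ℝ (deriv f) (Ioi 0) := h2.differentiableOn (by norm_num)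
  exact ⟨(h1.differentiableAt (Ioi_mem_nhds hx)).hasDerivAt,
    (h3.differentiableAt (Ioi_mem_nhds hx)).hasDerivAt⟩

lemma range_of {f : ℝ → ℝ} {l : ℝ} (m : StrictMonoOn f (Ici 0)) (z : f 0 = 0)
    (t : Tendsto f atTop (𝓝 l)) : ∀ x ∈ Ioi (0:ℝ), f x ∈ Icc 0 l := by
  intro x hx
  have hx : 0 < x := hx
  constructor
  · rw [← z]; exact (m (mem_Ici.2 le_rfl) hx.le hx).le
  · refine ge_of_tendsto t ?_
    filter_upwards [eventually_ge_atTop x] with y hy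
    exact m.monotoneOn hx.le (hx.le.trans hy) hy

lemma tend0_of {f : ℝ → ℝ} (h : ContDiffOn ℝ 2 f (Ici 0)) (z : f 0 = 0) :
    Tendsto f (𝓝[>] 0) (𝓝 0) := by
  have := h.continuousOn 0 (mem_Ici.2 le_rfl)
  unfold ContinuousWithinAt at this
  rw [z] at this
  exact this.mono_left (nhdsWithin_mono _ Ioi_subset_Ici_self)

lemma Z0_of_inc {d1 d2 a b c d u v L s : ℝ} {F G φ ψ : ℝ → ℝ}
    (g : Good ⟨d1, d2, a, b, c, d, u, v, L, F, G⟩) (hs : 0 ≤ s)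
    (h : IncSemiWave d1 d2 a b c d F G u v s φ ψ) :
    Z0 ⟨d1, d2, a, b, c, d, u, v, L, F, G⟩ s φ ψ (deriv φ) (deriv ψ) ∧ ∃ x > 0, 0 < φ x := by
  obtain ⟨w, m1, m2⟩ := h
  have h1 : 0 < d1 := g.d1
  have h2 : 0 < d2 := g.d2
  have M : MS ⟨d1, d2, a, b, c, d, u, v, L, F, G⟩ s (Ioi 0) φ ψ (deriv φ) (deriv ψ) := by
    refine ⟨isOpen_Ioi, isUpperSet_Ioi _, fun x hx => (der_of w.regφ hx).1,
      fun x hx => (der_of w.regψ hx).1, fun x hx => ?_, fun x hx => ?_,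
      m1.monotoneOn.mono Ioi_subset_Ici_self, m2.monotoneOn.mono Ioi_subset_Ici_self,
      range_of m1 w.zeroφ w.limφ, range_of m2 w.zeroψ w.limψ⟩
    · have e := w.odeφ x hx
      convert (der_of w.regφ hx).2 using 1
      rw [div_eq_iff h1.ne']; simp only; linarith
    · have e := w.odeψ x hx
      convert (der_of w.regψ hx).2 using 1
      rw [div_eq_iff h2.ne']; simp only; linarith
  refine ⟨⟨M, w.zeroφ, w.zeroψ, fun x hx => ?_, fun x hx => ?_⟩, 1, one_pos, ?_⟩
  · have := bd_of_tend g hs M (tend0_of w.regφ w.zeroφ) x hx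
    rwa [zero_add] at this
  · have := bd_of_tend g.swap hs M.swap (tend0_of w.regψ w.zeroψ) x hx
    rwa [zero_add] at this
  · have := m1 (mem_Ici.2 le_rfl) (mem_Ici.2 zero_le_one) one_pos
    rwa [w.zeroφ] at this

lemma strict_Ici {f : ℝ → ℝ} (z : f 0 = 0) (p : ∀ x > 0, 0 < f x) (m : StrictMonoOn f (Ioi 0)) :
    StrictMonoOn f (Ici 0) := by
  intro x hx y hy hxy
  rcases eq_or_lt_of_le (mem_Ici.1 hx) with h0 | h0
  · subst h0; rw [z]; exact p y hxy
  · exact m h0 (h0.trans hxy) hxy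

lemma inc_of_Z0 {d1 d2 a b c d u v L s : ℝ} {F G φ ψ φ1 ψ1 : ℝ → ℝ}
    (g : Good ⟨d1, d2, a, b, c, d, u, v, L, F, G⟩) (hs : 0 ≤ s)
    (h : Z0 ⟨d1, d2, a, b, c, d, u, v, L, F, G⟩ s φ ψ φ1 ψ1) (hp : ∃ x > 0, 0 < φ x) :
    IncSemiWave d1 d2 a b c d F G u v s φ ψ := by
  obtain ⟨x0, hx0, hpx⟩ := hp
  obtain ⟨⟨m1, m2⟩, pp, t1, t2⟩ := h.props g hs hx0 hpx
  have h1 : 0 < d1 := g.d1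
  have h2 : 0 < d2 := g.d2
  have e1 : ∀ x > 0, deriv φ x = φ1 x := fun x hx => (h.ms.hφ x hx).deriv
  have e2 : ∀ x > 0, deriv ψ x = ψ1 x := fun x hx => (h.ms.hψ x hx).deriv
  refine ⟨⟨h.c2 g hs, h.swap.c2 g.swap hs, fun x hx => ?_, fun x hx => ?_, h.z1, h.z2, t1, t2⟩,
    strict_Ici h.z1 (fun x hx => (pp x hx).1) m1, strict_Ici h.z2 (fun x hx => (pp x hx).2) m2⟩
  · have ee : deriv φ =ᶠ[𝓝 x] φ1 := by
      filter_upwards [Ioi_mem_nhds hx] with y hy using e1 y hy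
    rw [ee.deriv_eq, e1 x hx, (h.ms.hφ1 x hx).deriv, mul_div_cancel₀ _ h1.ne']
    simp only; ring
  · have ee : deriv ψ =ᶠ[𝓝 x] ψ1 := by
      filter_upwards [Ioi_mem_nhds hx] with y hy using e2 y hy
    rw [ee.deriv_eq, e2 x hx, (h.ms.hψ1 x hx).deriv, mul_div_cancel₀ _ h2.ne']
    simp only; ring

theorem statement6
    (d1 d2 a b c d : ℝ)
    (hd1 : 0 < d1) (hd2 : 0 < d2) (ha : 0 < a) (hb : 0 < b) (hc : 0 < c) (hd : 0 < d)
    (hbcad : 0 < b * c - a * d)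
    (F G : ℝ → ℝ) (hA : CondA F G)
    (ustar vstar : ℝ) (hEq : IsEquilibrium a b c d F G ustar vstar)
    :
    ∃ sstar : ℝ, IsCriticalSpeed d1 d2 a b c d F G ustar vstar sstar ∧
      ∀ μ ρ : ℝ, 0 < μ → 0 < ρ →
        ∃! s : ℝ, s ∈ Ioo 0 sstar ∧
          ∃ φ ψ : ℝ → ℝ, IncSemiWave d1 d2 a b c d F G ustar vstar s φ ψ ∧
            μ * (derivWithin ψ (Ici 0) 0 + ρ * derivWithin φ (Ici 0) 0) = s := by
  obtain ⟨L, g⟩ := exists_par hd1 hd2 ha hb hc hd hbcad hA hEq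
  obtain ⟨S, hS, low, high⟩ := exists_sstar g
  refine ⟨S, ⟨hS, fun s hs hsS => ?_, fun s hs => ?_⟩, fun μ ρ hμ hρ => ?_⟩
  · obtain ⟨φ, ψ, φ1, ψ1, hz, hp⟩ := low s hs hsS
    refine ⟨φ, ψ, inc_of_Z0 g hs hz hp, fun φ' ψ' h' => ?_⟩
    obtain ⟨hz', hp'⟩ := Z0_of_inc g hs h'
    exact hz.uniq g hs hz' hp hp'
  · rintro ⟨φ, ψ, h⟩
    obtain ⟨hz, hp⟩ := Z0_of_inc g (hS.le.trans hs) h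
    exact high s hs ⟨φ, ψ, _, _, hz, hp⟩
  · obtain ⟨s, hs, φ, ψ, φ1, ψ1, hz, hp, e⟩ := speed_exists g hμ hρ hS low (high S le_rfl)
    refine ⟨s, ⟨hs, φ, ψ, inc_of_Z0 g hs.1.le hz hp, e⟩, ?_⟩
    rintro s' ⟨hs', φ', ψ', h', e'⟩
    obtain ⟨hz', hp'⟩ := Z0_of_inc g hs'.1.le h'
    have e' : μ * (dW ψ' + ρ * dW φ') = s' := e'
    rcases le_total s s' with hle | hle
    · have := mul_le_mul_of_nonneg_left (speed_mono g hρ hs.1.le hle hz' hz hp) hμ.le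
      exact le_antisymm (by linarith) hle
    · have := mul_le_mul_of_nonneg_left (speed_mono g hρ hs'.1.le hle hz hz' hp') hμ.le
      exact le_antisymm hle (by linarith)

end
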